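/- arXiv:2401.10575 — 6 statements merged into one kernel-verified Lean document; each statement's English description precedes it below -/
import Mathlib

section
/- Let k₀ ∈ (0,1), let β be a fragment daughter distribution satisfying the mass-transfer form, local mass conservation, and the non-integrability bounds, let Φ be the collision kernel with exponents k₀ ≤ λ₁ ≤ λ₂ ≤ 1, let T ∈ (0,∞], and let u be a weak solution to the collision-induced fragmentation equation on [0,T) with nonnegative initial condition u^in ∈ X_{k₀} ∩ X₁. If ∫₀^t ∫₀^∞ ∫₀^∞ (x₁+x₂) Φ(x₁,x₂) u(τ,x₁) u(τ,x₂) dx₁ dx₂ dτ < ∞ for every t ∈ (0,T), then u is mass-conserving on [0,T), i.e. M₁(u(t)) = M₁(u^in) for all t ∈ [0,T). -/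
open MeasureTheory Set Filter
open scoped ENNReal

noncomputable section

/-- The `k`-th moment `M_k(g) = ∫₀^∞ x^k g(x) dx`. -/
def Mk (k : ℝ) (g : ℝ → ℝ) : ℝ := ∫ x in Ioi (0:ℝ), x ^ k * g x

/-- Membership in the weighted space `X_k`. -/
def MemXk (k : ℝ) (g : ℝ → ℝ) : Prop :=
  MeasureTheory.IntegrableOn (fun x => x ^ k * g x) (Ioi (0:ℝ))

/-- The fragment daughter distribution built from `β_*` via the mass-transfer form
`β(x₃,x₁,x₂) = β_*(x₃,x₁,x₂)·1_{(0,x₁)}(x₃) + β_*(x₃,x₂,x₁)·1_{(0,x₂)}(x₃)`. -/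
def betaOf (bs : ℝ → ℝ → ℝ → ℝ) (x₃ x₁ x₂ : ℝ) : ℝ :=
  (if x₃ ∈ Ioo (0:ℝ) x₁ then bs x₃ x₁ x₂ else 0) +
  (if x₃ ∈ Ioo (0:ℝ) x₂ then bs x₃ x₂ x₁ else 0)

/-- The power-law `β_*(x₃,x₁,x₂) = (ν+2) x₃^ν x₁^{-ν-1} 1_{(0,x₁)}(x₃)`. -/
def betaPow (ν : ℝ) (x₃ x₁ x₂ : ℝ) : ℝ :=
  if x₃ ∈ Ioo (0:ℝ) x₁ then (ν + 2) * x₃ ^ ν * x₁ ^ (-ν - 1) else 0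

/-- The collision kernel `Φ(x₁,x₂) = x₁^{λ₁} x₂^{λ₂} + x₂^{λ₁} x₁^{λ₂}`. -/
def Phi (l₁ l₂ : ℝ) (x₁ x₂ : ℝ) : ℝ := x₁ ^ l₁ * x₂ ^ l₂ + x₂ ^ l₁ * x₁ ^ l₂

/-- `Υ_ς(x₁,x₂) = ∫₀^{x₁+x₂} ς(x₃) β(x₃,x₁,x₂) dx₃ - ς(x₁) - ς(x₂)`, where `β = betaOf bs`. -/
def Upsilon (bs : ℝ → ℝ → ℝ → ℝ) (ς : ℝ → ℝ) (x₁ x₂ : ℝ) : ℝ :=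
  (∫ x₃ in Ioo (0:ℝ) (x₁ + x₂), ς x₃ * betaOf bs x₃ x₁ x₂) - ς x₁ - ς x₂

/-- Assumptions on `β_*`: measurability, nonnegativity, local mass conservation, and the
non-integrability bounds `∫₀^{x₁} x₃^{k₀} β_*(x₃,x₁,x₂)^p dx₃ ≤ E_{k₀,p} x₁^{k₀+1-p}`
for `p ∈ [1,p₀]`, some `p₀ ∈ (1,1+k₀)`. -/
structure FragKernel (k₀ : ℝ) (bs : ℝ → ℝ → ℝ → ℝ) : Prop where
  meas : Measurable fun q : ℝ × ℝ × ℝ => bs q.1 q.2.1 q.2.2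
  nonneg : ∀ x₃ x₁ x₂ : ℝ, 0 ≤ bs x₃ x₁ x₂
  mass : ∀ x₁ ∈ Ioi (0:ℝ), ∀ x₂ ∈ Ioi (0:ℝ),
    ∫ x₃ in Ioo (0:ℝ) x₁, x₃ * bs x₃ x₁ x₂ = x₁
  bound : ∃ p₀ ∈ Ioo (1:ℝ) (1 + k₀), ∀ p ∈ Icc (1:ℝ) p₀, ∃ E : ℝ, 0 < E ∧
    ∀ x₁ ∈ Ioi (0:ℝ), ∀ x₂ ∈ Ioi (0:ℝ),
      ∫ x₃ in Ioo (0:ℝ) x₁, x₃ ^ k₀ * (bs x₃ x₁ x₂) ^ p ≤ E * x₁ ^ (k₀ + 1 - p)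

/-- `ς(0) = 0` and `ς` is Hölder continuous with exponent `k₀` on `[0,∞)`. -/
def HolderZero (k₀ : ℝ) (ς : ℝ → ℝ) : Prop :=
  ς 0 = 0 ∧ ∃ H : ℝ, ∀ a b : ℝ, 0 ≤ a → 0 ≤ b → |ς a - ς b| ≤ H * |a - b| ^ k₀

/-- `ς` is bounded on `[0,∞)`. -/
def BddOnNonneg (ς : ℝ → ℝ) : Prop := ∃ C : ℝ, ∀ x : ℝ, 0 ≤ x → |ς x| ≤ C

/-- A weak solution on `[0,T)` to the collision-induced fragmentation equation with
daughter distribution `betaOf bs` and collision kernel `K`. -/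
structure IsWeakSolution (k₀ : ℝ) (bs : ℝ → ℝ → ℝ → ℝ) (K : ℝ → ℝ → ℝ)
    (uin : ℝ → ℝ) (T : ℝ≥0∞) (u : ℝ → ℝ → ℝ) : Prop where
  meas : Measurable (Function.uncurry u)
  nonneg : ∀ t : ℝ, 0 ≤ t → ENNReal.ofReal t < T → ∀ x ∈ Ioi (0:ℝ), 0 ≤ u t x
  init : ∀ x ∈ Ioi (0:ℝ), u 0 x = uin x
  cont : ∀ g : ℝ → ℝ, Measurable g → (∃ C : ℝ, ∀ x : ℝ, |g x| ≤ C) →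
    ContinuousOn (fun t => ∫ x in Ioi (0:ℝ), g x * (x ^ k₀ * u t x))
      {t : ℝ | 0 ≤ t ∧ ENNReal.ofReal t < T}
  massBdd : ∃ C : ℝ, ∀ t : ℝ, 0 ≤ t → ENNReal.ofReal t < T →
    (∫⁻ x in Ioi (0:ℝ), ENNReal.ofReal (x * u t x)) ≤ ENNReal.ofReal C
  integ : ∀ t : ℝ, 0 < t → ENNReal.ofReal t < T →
    MeasureTheory.IntegrableOn
      (fun q : ℝ × ℝ × ℝ =>
        (q.2.1 ^ k₀ + q.2.2 ^ k₀) * K q.2.1 q.2.2 * u q.1 q.2.1 * u q.1 q.2.2)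
      (Ioo (0:ℝ) t ×ˢ (Ioi (0:ℝ) ×ˢ Ioi (0:ℝ)))
  weak : ∀ t : ℝ, 0 < t → ENNReal.ofReal t < T → ∀ ς : ℝ → ℝ,
    HolderZero k₀ ς → BddOnNonneg ς →
    ∫ x in Ioi (0:ℝ), ς x * u t x =
      (∫ x in Ioi (0:ℝ), ς x * uin x) +
      (1/2) * ∫ τ in Ioo (0:ℝ) t, ∫ x₁ in Ioi (0:ℝ), ∫ x₂ in Ioi (0:ℝ),
        Upsilon bs ς x₁ x₂ * K x₁ x₂ * u τ x₁ * u τ x₂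

/-- Mass conservation on `[0,T)`. -/
def MassConserving (uin : ℝ → ℝ) (T : ℝ≥0∞) (u : ℝ → ℝ → ℝ) : Prop :=
  ∀ t : ℝ, 0 ≤ t → ENNReal.ofReal t < T → Mk 1 (u t) = Mk 1 uin

/-- The formation term `F` with kernel `K`. -/
def Fform (bs : ℝ → ℝ → ℝ → ℝ) (K : ℝ → ℝ → ℝ) (v : ℝ → ℝ) (x₁ : ℝ) : ℝ :=
  (1/2) * ∫ x₂ in Ioi x₁, ∫ x₃ in Ioo (0:ℝ) x₂,
    betaOf bs x₁ (x₂ - x₃) x₃ * K (x₂ - x₃) x₃ * v (x₂ - x₃) * v x₃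

/-- The loss term `L` with kernel `K`. -/
def Lform (K : ℝ → ℝ → ℝ) (v : ℝ → ℝ) (x₁ : ℝ) : ℝ :=
  v x₁ * ∫ x₂ in Ioi (0:ℝ), K x₁ x₂ * v x₂

/-- The norm of `X_{k₀} ∩ X₁`, i.e. the `L¹` norm with weight `x^{k₀} + x`. -/
def N01 (k₀ : ℝ) (g : ℝ → ℝ) : ℝ := ∫ x in Ioi (0:ℝ), (x ^ k₀ + x) * |g x|

/-- The truncated collision kernel `Φ_n`. -/
def PhiTrunc (l₁ l₂ : ℝ) (n : ℕ) (x₁ x₂ : ℝ) : ℝ :=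
  if x₁ ∈ Ioo ((n:ℝ)⁻¹) (n:ℝ) ∧ x₂ ∈ Ioo ((n:ℝ)⁻¹) (n:ℝ) then Phi l₁ l₂ x₁ x₂ else 0

/-- `u` is a continuously differentiable curve in `X_{k₀} ∩ X₁` on `[0,∞)`, with `u(0) = v0`,
solving `∂ₜ u = F u - L u` in the strong (norm) sense; the derivative
`t ↦ F u(t) - L u(t)` is moreover continuous in the norm of `X_{k₀} ∩ X₁`. -/
def SolvesTrunc (k₀ : ℝ) (bs : ℝ → ℝ → ℝ → ℝ) (K : ℝ → ℝ → ℝ) (v0 : ℝ → ℝ)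
    (u : ℝ → ℝ → ℝ) : Prop :=
  Measurable (Function.uncurry u) ∧
  (∀ x ∈ Ioi (0:ℝ), u 0 x = v0 x) ∧
  (∀ t : ℝ, 0 ≤ t → MemXk k₀ (u t) ∧ MemXk 1 (u t)) ∧
  (∀ t : ℝ, 0 ≤ t →
    Tendsto (fun h : ℝ =>
        N01 k₀ (fun x => (u (t + h) x - u t x) / h - (Fform bs K (u t) x - Lform K (u t) x)))
      (nhdsWithin 0 {h : ℝ | h ≠ 0 ∧ 0 ≤ t + h}) (nhds 0)) ∧
  (∀ t₀ : ℝ, 0 ≤ t₀ →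
    Tendsto (fun t : ℝ =>
        N01 k₀ (fun x =>
          (Fform bs K (u t) x - Lform K (u t) x) - (Fform bs K (u t₀) x - Lform K (u t₀) x)))
      (nhdsWithin t₀ (Ici (0:ℝ))) (nhds 0))

/-- Bundled data and standing assumptions of the paper. -/
structure Setup where
  k₀ : ℝ
  l₁ : ℝ
  l₂ : ℝ
  bs : ℝ → ℝ → ℝ → ℝ
  E₁ : ℝ
  uin : ℝ → ℝ
  hk₀ : k₀ ∈ Ioo (0:ℝ) 1
  hl₁ : k₀ ≤ l₁
  hl₁₂ : l₁ ≤ l₂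
  hl₂ : l₂ ≤ 1
  hβ : FragKernel k₀ bs
  hE₁pos : 0 < E₁
  hE₁ : ∀ x₁ ∈ Ioi (0:ℝ), ∀ x₂ ∈ Ioi (0:ℝ),
    ∫ x₃ in Ioo (0:ℝ) x₁, x₃ ^ k₀ * bs x₃ x₁ x₂ ≤ E₁ * x₁ ^ k₀
  hmeas : Measurable uin
  hnn : ∀ x : ℝ, 0 ≤ uin x
  hXk₀ : MemXk k₀ uin
  hX1 : MemXk 1 uin
  hX1k₀ : MemXk (1 + k₀) uin
  hρ : 0 < Mk 1 uin

/-- Apply a function of the seven quantities `k₀, λ₁, λ₂, ρ, M_{k₀}(u^in), M_{k₀+1}(u^in), E_{k₀,1}`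
to the data of a setup. -/
def app7 {α : Sort*} (f : ℝ → ℝ → ℝ → ℝ → ℝ → ℝ → ℝ → α) (S : Setup) : α :=
  f S.k₀ S.l₁ S.l₂ (Mk 1 S.uin) (Mk S.k₀ S.uin) (Mk (S.k₀ + 1) S.uin) S.E₁

/-- A nonnegative `C¹` solution of the truncated equation with truncated initial condition,
satisfying the mass bound and the `(k₀+1)`-moment bound. -/
def IsTruncSolution (S : Setup) (n : ℕ) (u : ℝ → ℝ → ℝ) : Prop :=
  SolvesTrunc S.k₀ S.bs (PhiTrunc S.l₁ S.l₂ n) ((Ioo (0:ℝ) (2 * n)).indicator S.uin) u ∧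
  (∀ t : ℝ, 0 ≤ t → ∀ x ∈ Ioi (0:ℝ), 0 ≤ u t x) ∧
  (∀ t : ℝ, 0 ≤ t → Mk 1 (u t) ≤ Mk 1 S.uin) ∧
  (∀ t : ℝ, 0 ≤ t → Mk (S.k₀ + 1) (u t) ≤ Mk (S.k₀ + 1) S.uin)

end

noncomputable section

/-- The truncated identity used as test function. -/
def trunc (A x : ℝ) : ℝ := min x A

lemma trunc_cont (A : ℝ) : Continuous (trunc A) := continuous_id.min continuous_const

lemma trunc_nonneg {A x : ℝ} (hA : 0 ≤ A) (hx : 0 ≤ x) : 0 ≤ trunc A x := le_min hx hA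

lemma trunc_le (A x : ℝ) : trunc A x ≤ x := min_le_left _ _

lemma trunc_le' (A x : ℝ) : trunc A x ≤ A := min_le_right _ _

lemma trunc_eq {A x : ℝ} (h : x ≤ A) : trunc A x = x := min_eq_left h

lemma trunc_bdd {A : ℝ} (hA : 0 ≤ A) : BddOnNonneg (trunc A) :=
  ⟨A, fun x hx => by
    rw [abs_of_nonneg (trunc_nonneg hA hx)]
    exact trunc_le' A x⟩

lemma trunc_holder {k₀ A : ℝ} (hk₀ : k₀ ∈ Ioo (0:ℝ) 1) (hA : 0 < A) :
    HolderZero k₀ (trunc A) := by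
  refine ⟨by simp [trunc, hA.le], A ^ (1 - k₀), fun a b ha hb => ?_⟩
  have h1 : |trunc A a - trunc A b| ≤ |a - b| := by
    simpa [trunc] using abs_min_sub_min_le_max a A b A
  have h2 : |trunc A a - trunc A b| ≤ A := by
    rw [abs_sub_le_iff]
    have := trunc_nonneg hA.le ha
    have := trunc_nonneg hA.le hb
    have := trunc_le' A a
    have := trunc_le' A b
    constructor <;> linarith
  have h0 := abs_nonneg (trunc A a - trunc A b)
  set d := |trunc A a - trunc A b| with hd
  rcases h0.eq_or_lt with h | h
  · rw [← h]; positivity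
  · calc d = d ^ (1 - k₀) * d ^ k₀ := by
          rw [← Real.rpow_add h]; simp
      _ ≤ A ^ (1 - k₀) * |a - b| ^ k₀ := by
          have := hk₀.1
          have := hk₀.2
          gcongr

lemma part_integrable {k₀ : ℝ} {bs : ℝ → ℝ → ℝ → ℝ} (hβ : FragKernel k₀ bs) {x₁ x₂ : ℝ}
    (h₁ : 0 < x₁) (h₂ : 0 < x₂) :
    IntegrableOn (fun x₃ => x₃ * bs x₃ x₁ x₂) (Ioo 0 x₁) := by
  by_contra h
  have := hβ.mass x₁ h₁ x₂ h₂
  rw [integral_undef h] at this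
  exact h₁.ne this

/-- Integrability and value of the first moment of one half of `β`. -/
lemma half_aux {k₀ : ℝ} {bs : ℝ → ℝ → ℝ → ℝ} (hβ : FragKernel k₀ bs) {x₁ x₂ s : ℝ}
    (h₁ : 0 < x₁) (h₂ : 0 < x₂) (hs : x₁ ≤ s) :
    IntegrableOn (fun x₃ => x₃ * (if x₃ ∈ Ioo (0:ℝ) x₁ then bs x₃ x₁ x₂ else 0)) (Ioo 0 s) ∧
    ∫ x₃ in Ioo 0 s, x₃ * (if x₃ ∈ Ioo (0:ℝ) x₁ then bs x₃ x₁ x₂ else 0) = x₁ := by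
  have he : (fun x₃ => x₃ * (if x₃ ∈ Ioo (0:ℝ) x₁ then bs x₃ x₁ x₂ else 0))
      = (Ioo (0:ℝ) x₁).indicator (fun x₃ => x₃ * bs x₃ x₁ x₂) := by
    ext x
    simp only [indicator, mul_ite, mul_zero]
  have hsub : Ioo (0:ℝ) x₁ ⊆ Ioo 0 s := Ioo_subset_Ioo_right hs
  rw [he]
  constructor
  · exact (IntegrableOn.integrable_indicator (part_integrable hβ h₁ h₂)
      measurableSet_Ioo).integrableOn
  · rw [setIntegral_indicator measurableSet_Ioo, inter_eq_self_of_subset_right hsub]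
    exact hβ.mass x₁ h₁ x₂ h₂

lemma full_aux {k₀ : ℝ} {bs : ℝ → ℝ → ℝ → ℝ} (hβ : FragKernel k₀ bs) {x₁ x₂ : ℝ}
    (h₁ : 0 < x₁) (h₂ : 0 < x₂) :
    IntegrableOn (fun x₃ => x₃ * betaOf bs x₃ x₁ x₂) (Ioo 0 (x₁ + x₂)) ∧
    ∫ x₃ in Ioo 0 (x₁ + x₂), x₃ * betaOf bs x₃ x₁ x₂ = x₁ + x₂ := by
  obtain ⟨i1, e1⟩ := half_aux hβ h₁ h₂ (s := x₁ + x₂) (by linarith)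
  obtain ⟨i2, e2⟩ := half_aux hβ h₂ h₁ (s := x₁ + x₂) (by linarith)
  simp only [betaOf, mul_add]
  refine ⟨i1.add i2, ?_⟩
  rw [integral_add i1 i2, e1, e2]

lemma betaOf_nonneg {k₀ : ℝ} {bs : ℝ → ℝ → ℝ → ℝ} (hβ : FragKernel k₀ bs) (x₃ x₁ x₂ : ℝ) :
    0 ≤ betaOf bs x₃ x₁ x₂ := by
  unfold betaOf
  have := hβ.nonneg x₃ x₁ x₂
  have := hβ.nonneg x₃ x₂ x₁
  split_ifs <;> linarith

lemma Upsilon_eq_zero {k₀ : ℝ} {bs : ℝ → ℝ → ℝ → ℝ} (hβ : FragKernel k₀ bs) {A x₁ x₂ : ℝ}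
    (h₁ : 0 < x₁) (h₂ : 0 < x₂) (hA : x₁ + x₂ ≤ A) : Upsilon bs (trunc A) x₁ x₂ = 0 := by
  have : ∫ x₃ in Ioo 0 (x₁ + x₂), trunc A x₃ * betaOf bs x₃ x₁ x₂ = x₁ + x₂ := by
    refine Eq.trans ?_ (full_aux hβ h₁ h₂).2
    refine setIntegral_congr_fun measurableSet_Ioo fun x hx => ?_
    have hx' : x ≤ A := (le_of_lt hx.2).trans hA
    simp only [trunc_eq hx']
  unfold Upsilon
  rw [this, trunc_eq (by linarith), trunc_eq (by linarith)]
  ring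

lemma Upsilon_abs_le {k₀ : ℝ} {bs : ℝ → ℝ → ℝ → ℝ} (hβ : FragKernel k₀ bs) {A x₁ x₂ : ℝ}
    (h₁ : 0 < x₁) (h₂ : 0 < x₂) (hA : 0 ≤ A) : |Upsilon bs (trunc A) x₁ x₂| ≤ x₁ + x₂ := by
  obtain ⟨i, e⟩ := full_aux hβ h₁ h₂
  have hle : ∫ x₃ in Ioo 0 (x₁ + x₂), trunc A x₃ * betaOf bs x₃ x₁ x₂ ≤ x₁ + x₂ := by
    refine le_trans ?_ e.le
    refine integral_mono_of_nonneg ?_ i ?_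
    · refine (ae_restrict_iff' measurableSet_Ioo).2 (Eventually.of_forall fun x hx => ?_)
      exact mul_nonneg (trunc_nonneg hA hx.1.le) (betaOf_nonneg hβ _ _ _)
    · refine Eventually.of_forall fun x => ?_
      exact mul_le_mul_of_nonneg_right (trunc_le A x) (betaOf_nonneg hβ _ _ _)
  have hge : 0 ≤ ∫ x₃ in Ioo 0 (x₁ + x₂), trunc A x₃ * betaOf bs x₃ x₁ x₂ :=
    setIntegral_nonneg measurableSet_Ioo fun x hx =>
      mul_nonneg (trunc_nonneg hA hx.1.le) (betaOf_nonneg hβ _ _ _)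
  have a1 := trunc_nonneg hA h₁.le
  have a2 := trunc_nonneg hA h₂.le
  have b1 := trunc_le A x₁
  have b2 := trunc_le A x₂
  unfold Upsilon
  rw [abs_le]
  constructor <;> linarith

lemma Upsilon_meas {k₀ : ℝ} {bs : ℝ → ℝ → ℝ → ℝ} (hβ : FragKernel k₀ bs) (A : ℝ) :
    Measurable (fun y : ℝ × ℝ => Upsilon bs (trunc A) y.1 y.2) := by
  have hm1 : Measurable (fun z : (ℝ × ℝ) × ℝ => bs z.2 z.1.1 z.1.2) :=
    hβ.meas.comp (g := fun q : ℝ × ℝ × ℝ => bs q.1 q.2.1 q.2.2)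
      (f := fun z : (ℝ × ℝ) × ℝ => (z.2, z.1.1, z.1.2)) (by fun_prop)
  have hm2 : Measurable (fun z : (ℝ × ℝ) × ℝ => bs z.2 z.1.2 z.1.1) :=
    hβ.meas.comp (g := fun q : ℝ × ℝ × ℝ => bs q.1 q.2.1 q.2.2)
      (f := fun z : (ℝ × ℝ) × ℝ => (z.2, z.1.2, z.1.1)) (by fun_prop)
  have hs (f : ℝ × ℝ → ℝ) (hf : Measurable f) :
      MeasurableSet {z : (ℝ × ℝ) × ℝ | z.2 ∈ Ioo (0:ℝ) (f z.1)} := by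
    have : {z : (ℝ × ℝ) × ℝ | z.2 ∈ Ioo (0:ℝ) (f z.1)}
        = {z | 0 < z.2} ∩ {z | z.2 < f z.1} := rfl
    rw [this]
    exact (measurableSet_lt measurable_const measurable_snd).inter
      (measurableSet_lt measurable_snd (hf.comp measurable_fst))
  have hb : Measurable (fun z : (ℝ × ℝ) × ℝ => betaOf bs z.2 z.1.1 z.1.2) := by
    unfold betaOf
    exact (Measurable.ite (hs _ measurable_fst) hm1 measurable_const).add
      (Measurable.ite (hs _ measurable_snd) hm2 measurable_const)
  have ht : Measurable (trunc A) := (trunc_cont A).measurable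
  have hF : Measurable (fun z : (ℝ × ℝ) × ℝ =>
      {z : (ℝ × ℝ) × ℝ | z.2 ∈ Ioo (0:ℝ) (z.1.1 + z.1.2)}.indicator
        (fun z => trunc A z.2 * betaOf bs z.2 z.1.1 z.1.2) z) :=
    ((ht.comp measurable_snd).mul hb).indicator
      (hs (fun y => y.1 + y.2) (by fun_prop))
  have hI := (hF.stronglyMeasurable.integral_prod_right' (ν := (volume : Measure ℝ))).measurable
  have he : (fun y : ℝ × ℝ => ∫ x₃ in Ioo 0 (y.1 + y.2), trunc A x₃ * betaOf bs x₃ y.1 y.2)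
      = fun y : ℝ × ℝ => ∫ x : ℝ, {z : (ℝ × ℝ) × ℝ | z.2 ∈ Ioo (0:ℝ) (z.1.1 + z.1.2)}.indicator
        (fun z => trunc A z.2 * betaOf bs z.2 z.1.1 z.1.2) (y, x) := by
    ext y
    rw [← integral_indicator measurableSet_Ioo]
    rfl
  unfold Upsilon
  refine Measurable.sub (Measurable.sub ?_ (ht.comp measurable_fst)) (ht.comp measurable_snd)
  rw [he]
  exact hI

/-- Convergence of the truncated first moments. -/
lemma moment_tendsto {g : ℝ → ℝ} (hg : Measurable g)
    (hi : IntegrableOn (fun x => x * g x) (Ioi (0:ℝ))) :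
    Tendsto (fun n : ℕ => ∫ x in Ioi (0:ℝ), trunc n x * g x) atTop
      (nhds (∫ x in Ioi (0:ℝ), x * g x)) := by
  refine tendsto_integral_of_dominated_convergence (fun x => ‖x * g x‖) ?_ hi.norm ?_ ?_
  · intro n
    exact ((trunc_cont n).measurable.mul hg).aestronglyMeasurable
  · intro n
    refine (ae_restrict_iff' measurableSet_Ioi).2 (Eventually.of_forall fun x hx => ?_)
    have hx : 0 < x := hx
    rw [norm_mul, norm_mul]
    gcongr
    rw [Real.norm_of_nonneg (trunc_nonneg (Nat.cast_nonneg n) hx.le), Real.norm_of_nonneg hx.le]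
    exact trunc_le _ _
  · refine Eventually.of_forall fun x => ?_
    refine tendsto_const_nhds.congr' ?_
    obtain ⟨N, hN⟩ := exists_nat_ge x
    filter_upwards [eventually_ge_atTop N] with n hn
    rw [trunc_eq (hN.trans (Nat.cast_le.2 hn))]

lemma collision_tendsto {k₀ : ℝ} {bs : ℝ → ℝ → ℝ → ℝ} (hβ : FragKernel k₀ bs)
    {K : ℝ → ℝ → ℝ} (hK : Measurable (fun y : ℝ × ℝ => K y.1 y.2))
    {u : ℝ → ℝ → ℝ} (hu : Measurable (Function.uncurry u)) {t : ℝ}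
    (hint : IntegrableOn
        (fun q : ℝ × ℝ × ℝ => (q.2.1 + q.2.2) * K q.2.1 q.2.2 * u q.1 q.2.1 * u q.1 q.2.2)
        (Ioo (0:ℝ) t ×ˢ (Ioi (0:ℝ) ×ˢ Ioi (0:ℝ)))) :
    Tendsto (fun n : ℕ => ∫ τ in Ioo (0:ℝ) t, ∫ x₁ in Ioi (0:ℝ), ∫ x₂ in Ioi (0:ℝ),
        Upsilon bs (trunc n) x₁ x₂ * K x₁ x₂ * u τ x₁ * u τ x₂) atTop (nhds 0) := by
  set F : ℕ → ℝ × ℝ × ℝ → ℝ := fun n q =>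
    Upsilon bs (trunc n) q.2.1 q.2.2 * K q.2.1 q.2.2 * u q.1 q.2.1 * u q.1 q.2.2 with hF
  have hS : MeasurableSet (Ioo (0:ℝ) t ×ˢ (Ioi (0:ℝ) ×ˢ Ioi (0:ℝ))) :=
    measurableSet_Ioo.prod (measurableSet_Ioi.prod measurableSet_Ioi)
  have hFm : ∀ n, Measurable (F n) := by
    intro n
    have m1 : Measurable (fun q : ℝ × ℝ × ℝ => Upsilon bs (trunc n) q.2.1 q.2.2) :=
      (Upsilon_meas hβ n).comp measurable_snd
    have m2 : Measurable (fun q : ℝ × ℝ × ℝ => K q.2.1 q.2.2) := hK.comp measurable_snd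
    have m3 : Measurable (fun q : ℝ × ℝ × ℝ => u q.1 q.2.1) :=
      hu.comp (f := fun q : ℝ × ℝ × ℝ => (q.1, q.2.1)) (by fun_prop)
    have m4 : Measurable (fun q : ℝ × ℝ × ℝ => u q.1 q.2.2) :=
      hu.comp (f := fun q : ℝ × ℝ × ℝ => (q.1, q.2.2)) (by fun_prop)
    exact ((m1.mul m2).mul m3).mul m4
  have hFb : ∀ n, ∀ᵐ q ∂(volume.restrict (Ioo (0:ℝ) t ×ˢ (Ioi (0:ℝ) ×ˢ Ioi (0:ℝ)))),
      ‖F n q‖ ≤ ‖(q.2.1 + q.2.2) * K q.2.1 q.2.2 * u q.1 q.2.1 * u q.1 q.2.2‖ := by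
    intro n
    refine (ae_restrict_iff' hS).2 (Eventually.of_forall fun q hq => ?_)
    obtain ⟨-, h1, h2⟩ := hq
    have h1 : 0 < q.2.1 := h1
    have h2 : 0 < q.2.2 := h2
    simp only [hF, norm_mul]
    gcongr
    rw [Real.norm_of_nonneg (by linarith : 0 ≤ q.2.1 + q.2.2)]
    exact Upsilon_abs_le hβ h1 h2 (Nat.cast_nonneg n)
  have hFi : ∀ n, IntegrableOn (F n) (Ioo (0:ℝ) t ×ˢ (Ioi (0:ℝ) ×ˢ Ioi (0:ℝ))) := fun n =>
    Integrable.mono hint (hFm n).aestronglyMeasurable (hFb n)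
  have hmeq : (volume : Measure (ℝ × ℝ × ℝ)).restrict
        (Ioo (0:ℝ) t ×ˢ (Ioi (0:ℝ) ×ˢ Ioi (0:ℝ)))
      = (volume.restrict (Ioo (0:ℝ) t)).prod
        ((volume.restrict (Ioi (0:ℝ))).prod (volume.restrict (Ioi (0:ℝ)))) := by
    rw [Measure.prod_restrict, Measure.prod_restrict]
    rfl
  have hfub : ∀ n, ∫ q in Ioo (0:ℝ) t ×ˢ (Ioi (0:ℝ) ×ˢ Ioi (0:ℝ)), F n q
      = ∫ τ in Ioo (0:ℝ) t, ∫ x₁ in Ioi (0:ℝ), ∫ x₂ in Ioi (0:ℝ),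
        Upsilon bs (trunc n) x₁ x₂ * K x₁ x₂ * u τ x₁ * u τ x₂ := by
    intro n
    have hi := hFi n
    unfold IntegrableOn at hi
    rw [hmeq] at hi ⊢
    rw [integral_prod _ hi]
    refine integral_congr_ae ?_
    filter_upwards [hi.prod_right_ae] with τ hτ
    rw [integral_prod _ hτ]
  simp_rw [← hfub]
  have h0 : ∫ q : ℝ × ℝ × ℝ in Ioo (0:ℝ) t ×ˢ (Ioi (0:ℝ) ×ˢ Ioi (0:ℝ)), (0:ℝ) = 0 := by simp
  refine Tendsto.mono_right ?_ (le_of_eq (congrArg nhds h0))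
  refine tendsto_integral_of_dominated_convergence _
    (fun n => (hFm n).aestronglyMeasurable) hint.norm hFb ?_
  refine (ae_restrict_iff' hS).2 (Eventually.of_forall fun q hq => ?_)
  obtain ⟨-, h1, h2⟩ := hq
  refine tendsto_const_nhds.congr' ?_
  obtain ⟨N, hN⟩ := exists_nat_ge (q.2.1 + q.2.2)
  filter_upwards [eventually_ge_atTop N] with n hn
  simp only [hF]
  rw [Upsilon_eq_zero hβ h1 h2 (hN.trans (Nat.cast_le.2 hn))]
  ring

/-- A weak solution for which `(x₁+x₂) Φ(x₁,x₂) u u` is integrable on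
`(0,t) × (0,∞)²` for every `t ∈ (0,T)` is mass-conserving on `[0,T)`. -/
theorem mass_conservation_criterion
    (k₀ l₁ l₂ : ℝ) (hk₀ : k₀ ∈ Ioo (0:ℝ) 1)
    (bs : ℝ → ℝ → ℝ → ℝ) (hβ : FragKernel k₀ bs)
    (hl₁ : k₀ ≤ l₁) (hl₁₂ : l₁ ≤ l₂) (hl₂ : l₂ ≤ 1)
    (uin : ℝ → ℝ) (hmeas : Measurable uin) (hnn : ∀ x : ℝ, 0 ≤ uin x)
    (hXk₀ : MemXk k₀ uin) (hX1 : MemXk 1 uin)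
    (T : ℝ≥0∞) (hT : 0 < T)
    (u : ℝ → ℝ → ℝ) (hu : IsWeakSolution k₀ bs (Phi l₁ l₂) uin T u)
    (hint : ∀ t : ℝ, 0 < t → ENNReal.ofReal t < T →
      MeasureTheory.IntegrableOn
        (fun q : ℝ × ℝ × ℝ =>
          (q.2.1 + q.2.2) * Phi l₁ l₂ q.2.1 q.2.2 * u q.1 q.2.1 * u q.1 q.2.2)
        (Ioo (0:ℝ) t ×ˢ (Ioi (0:ℝ) ×ˢ Ioi (0:ℝ)))) :
    MassConserving uin T u := by
  intro t ht0 htT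
  rcases ht0.eq_or_lt with h | ht
  · subst h
    refine setIntegral_congr_fun measurableSet_Ioi fun x hx => ?_
    simp only [hu.init x hx]
  have hut : Measurable (u t) := hu.meas.comp measurable_prodMk_left
  have hint_u : IntegrableOn (fun x => x * u t x) (Ioi (0:ℝ)) := by
    obtain ⟨C, hC⟩ := hu.massBdd
    refine ⟨(measurable_id.mul hut).aestronglyMeasurable, ?_⟩
    rw [hasFiniteIntegral_iff_ofReal]
    · exact (hC t ht0 htT).trans_lt ENNReal.ofReal_lt_top
    · refine (ae_restrict_iff' measurableSet_Ioi).2 (Eventually.of_forall fun x hx => ?_)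
      exact mul_nonneg (le_of_lt hx) (hu.nonneg t ht0 htT x hx)
  have hint_in : IntegrableOn (fun x => x * uin x) (Ioi (0:ℝ)) := by
    have := hX1
    simpa only [MemXk, Real.rpow_one] using this
  have hK : Measurable (fun y : ℝ × ℝ => Phi l₁ l₂ y.1 y.2) := by
    unfold Phi
    fun_prop
  have hL := moment_tendsto hut hint_u
  have hR := (moment_tendsto hmeas hint_in).add
    ((collision_tendsto hβ hK hu.meas (hint t ht htT)).const_mul (1/2 : ℝ))
  have hE : ∀ᶠ n : ℕ in atTop, ∫ x in Ioi (0:ℝ), trunc n x * u t x =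
      (∫ x in Ioi (0:ℝ), trunc n x * uin x) +
      (1/2) * ∫ τ in Ioo (0:ℝ) t, ∫ x₁ in Ioi (0:ℝ), ∫ x₂ in Ioi (0:ℝ),
        Upsilon bs (trunc n) x₁ x₂ * Phi l₁ l₂ x₁ x₂ * u τ x₁ * u τ x₂ := by
    filter_upwards [eventually_gt_atTop 0] with n hn
    have hn' : (0:ℝ) < n := Nat.cast_pos.2 hn
    exact hu.weak t ht htT (trunc n) (trunc_holder hk₀ hn') (trunc_bdd hn'.le)
  have := tendsto_nhds_unique (hL.congr' hE) hR
  simp only [mul_zero, add_zero] at this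
  simpa only [Mk, Real.rpow_one] using this

end
end

section
/- Let k₀ ∈ (0,1), let β be a fragment daughter distribution satisfying the mass-transfer form, local mass conservation, and the non-integrability bounds, and let Φ be the collision kernel with exponents k₀ ≤ λ₁ ≤ λ₂ ≤ 1. Let Φ̄ be a nonnegative symmetric measurable kernel with Φ̄ ≤ Φ pointwise, let T ∈ (0,∞], and let u be a mass-conserving weak solution on [0,T) to the collision-induced fragmentation equation with kernel Φ̄ and nonnegative initial condition u^in ∈ X_{k₀} ∩ X₁, satisfying additionally ∫₀^t ∫₀^∞ ∫₀^∞ (x₁+x₂) Φ̄(x₁,x₂) u(τ,x₁) u(τ,x₂) dx₁ dx₂ dτ < ∞ for every t ∈ (0,T). If u^in ∈ X_k for some k ≥ 1, then ∫_{x₁}^∞ x₂^k u(t,x₂) dx₂ ≤ ∫_{x₁}^∞ x₂^k u^in(x₂) dx₂ for all (t,x₁) ∈ [0,T) × (0,∞); in particular M_k(u(t)) ≤ M_k(u^in) for all t ∈ [0,T). -/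
open MeasureTheory Set Filter
open scoped ENNReal

noncomputable section

/-- Truncated test function: equal to `x` on `[0,r]`, zero on `[s,∞)`. -/
def tf (M s x : ℝ) : ℝ := max 0 (min x (M * (s - x)))

lemma tf_nonneg (M s x : ℝ) : 0 ≤ tf M s x := le_max_left _ _

lemma tf_le {M s x : ℝ} (hx : 0 ≤ x) : tf M s x ≤ x := max_le hx (min_le_left _ _)

lemma tf_zero {M s x : ℝ} (hM : 0 ≤ M) (hx : s ≤ x) : tf M s x = 0 := by
  unfold tf
  apply max_eq_left
  exact (min_le_right _ _).trans (mul_nonpos_of_nonneg_of_nonpos hM (by linarith))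

lemma tf_bdd {M s x : ℝ} (hM : 0 ≤ M) (hs : 0 ≤ s) (hx : 0 ≤ x) : |tf M s x| ≤ s := by
  rw [abs_of_nonneg (tf_nonneg _ _ _)]
  rcases le_total s x with h | h
  · rw [tf_zero hM h]; exact hs
  · exact (tf_le hx).trans h

lemma tf_eq {M s r x : ℝ} (hM : 0 ≤ M) (hMr : M * (s - r) = r) (hx : 0 ≤ x) (hxr : x ≤ r) :
    tf M s x = x := by
  unfold tf
  have : r ≤ M * (s - x) := by
    calc r = M * (s - r) := hMr.symm
      _ ≤ M * (s - x) := mul_le_mul_of_nonneg_left (by linarith) hM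
  rw [min_eq_left (by linarith), max_eq_right hx]

lemma tf_lip {M s : ℝ} (hM : 0 ≤ M) (a b : ℝ) : |tf M s a - tf M s b| ≤ (1 + M) * |a - b| := by
  unfold tf
  have h1 := abs_max_sub_max_le_max (0:ℝ) (min a (M * (s - a))) 0 (min b (M * (s - b)))
  have h2 := abs_min_sub_min_le_max a (M * (s - a)) b (M * (s - b))
  have h3 : |M * (s - a) - M * (s - b)| = M * |a - b| := by
    rw [← mul_sub, abs_mul, abs_of_nonneg hM]
    congr 1
    rw [abs_sub_comm]; congr 1; ring
  have h4 : 0 ≤ |a - b| := abs_nonneg _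
  have h5 : 0 ≤ M * |a - b| := by positivity
  rw [h3] at h2
  have h6 : max |a - b| (M * |a - b|) ≤ (1 + M) * |a - b| := max_le (by linarith) (by linarith)
  simp only [sub_self, abs_zero] at h1
  refine h1.trans (max_le (by positivity) (h2.trans h6))

lemma tf_mono {M s x y : ℝ} (hM : 0 ≤ M) (hx : 0 < x) (hxy : x ≤ y) :
    tf M s y * x ≤ tf M s x * y := by
  rcases le_total s y with h | h
  · rw [tf_zero hM h, zero_mul]
    exact mul_nonneg (tf_nonneg _ _ _) (by linarith)
  · have hy : 0 < y := by linarith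
    have e : tf M s y = min y (M * (s - y)) := by
      unfold tf
      exact max_eq_right (le_min hy.le (mul_nonneg hM (by linarith)))
    have e2 : min x (M * (s - x)) ≤ tf M s x := le_max_right _ _
    calc tf M s y * x = min (y * x) (M * (s - y) * x) := by
          rw [e, min_mul_of_nonneg _ _ hx.le]
      _ ≤ min (x * y) (M * (s - x) * y) := by
          apply min_le_min (le_of_eq (mul_comm _ _))
          nlinarith [mul_le_mul_of_nonneg_left hxy (mul_nonneg hM (by linarith : (0:ℝ) ≤ s))]
      _ = min x (M * (s - x)) * y := by rw [min_mul_of_nonneg _ _ hy.le]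
      _ ≤ tf M s x * y := mul_le_mul_of_nonneg_right e2 hy.le

lemma tf_meas (M s : ℝ) : Measurable (tf M s) := by
  unfold tf; fun_prop

lemma tf_holder {k₀ M s : ℝ} (hk₀ : k₀ ∈ Ioo (0:ℝ) 1) (hM : 0 ≤ M) (hs : 0 ≤ s) :
    HolderZero k₀ (tf M s) := by
  refine ⟨le_antisymm (tf_le le_rfl) (tf_nonneg _ _ _), (1 + M) + 2 * s, ?_⟩
  intro a b ha hb
  have hp : 0 ≤ |a - b| ^ k₀ := Real.rpow_nonneg (abs_nonneg _) _
  rcases le_total |a - b| 1 with h | h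
  · have h1 : |a - b| ≤ |a - b| ^ k₀ := by
      rcases eq_or_lt_of_le (abs_nonneg (a - b)) with h0 | h0
      · rw [← h0, Real.zero_rpow hk₀.1.ne']
      · calc |a - b| = |a - b| ^ (1:ℝ) := (Real.rpow_one _).symm
          _ ≤ _ := Real.rpow_le_rpow_of_exponent_ge h0 h hk₀.2.le
    have h2 := tf_lip (s := s) hM a b
    have h3 : (1 + M) * |a - b| ≤ (1 + M) * |a - b| ^ k₀ :=
      mul_le_mul_of_nonneg_left h1 (by linarith)
    have : 0 ≤ 2 * s * |a - b| ^ k₀ := by positivity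
    linarith
  · have h1 : 1 ≤ |a - b| ^ k₀ := Real.one_le_rpow h hk₀.1.le
    have h2 := abs_sub (tf M s a) (tf M s b)
    have h3 := tf_bdd hM hs ha
    have h4 := tf_bdd hM hs hb
    have h5 : 2 * s * 1 ≤ 2 * s * |a - b| ^ k₀ := mul_le_mul_of_nonneg_left h1 (by linarith)
    have : 0 ≤ (1 + M) * |a - b| ^ k₀ := by positivity
    linarith

lemma tf_part {k₀ : ℝ} {bs : ℝ → ℝ → ℝ → ℝ} (hβ : FragKernel k₀ bs) {M s : ℝ} (hM : 0 ≤ M)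
    {x y : ℝ} (hx : 0 < x) (hy : 0 < y) :
    IntegrableOn (fun z => tf M s z * bs z x y) (Ioo 0 x) ∧
    tf M s x ≤ ∫ z in Ioo (0:ℝ) x, tf M s z * bs z x y := by
  have hm := hβ.mass x hx y hy
  have hbm : Measurable fun z => bs z x y :=
    hβ.meas.comp (g := fun q : ℝ × ℝ × ℝ => bs q.1 q.2.1 q.2.2) (f := fun z => (z, x, y))
      (by fun_prop)
  have hi : IntegrableOn (fun z => z * bs z x y) (Ioo 0 x) := by
    by_contra h
    rw [integral_undef h] at hm
    linarith
  have hi2 : IntegrableOn (fun z => tf M s z * bs z x y) (Ioo 0 x) := by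
    refine Integrable.mono' hi ((tf_meas M s).mul hbm).aestronglyMeasurable ?_
    filter_upwards [ae_restrict_mem measurableSet_Ioo] with z hz
    rw [Real.norm_eq_abs, abs_of_nonneg (mul_nonneg (tf_nonneg _ _ _) (hβ.nonneg _ _ _))]
    exact mul_le_mul_of_nonneg_right (tf_le hz.1.le) (hβ.nonneg _ _ _)
  refine ⟨hi2, ?_⟩
  calc tf M s x = (tf M s x / x) * ∫ z in Ioo (0:ℝ) x, z * bs z x y := by
        rw [hm]; field_simp
    _ = ∫ z in Ioo (0:ℝ) x, (tf M s x / x) * (z * bs z x y) := (integral_const_mul _ _).symm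
    _ ≤ _ := by
        refine setIntegral_mono_on (hi.const_mul _) hi2 measurableSet_Ioo ?_
        intro z hz
        rw [← mul_assoc]
        refine mul_le_mul_of_nonneg_right ?_ (hβ.nonneg _ _ _)
        rw [div_mul_eq_mul_div, div_le_iff₀ hx]
        exact tf_mono hM hz.1 hz.2.le

lemma upsilon_nonneg {k₀ : ℝ} {bs : ℝ → ℝ → ℝ → ℝ} (hβ : FragKernel k₀ bs) {M s : ℝ} (hM : 0 ≤ M)
    {x y : ℝ} (hx : 0 < x) (hy : 0 < y) : 0 ≤ Upsilon bs (tf M s) x y := by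
  obtain ⟨i1, j1⟩ := tf_part hβ (s := s) hM hx hy
  obtain ⟨i2, j2⟩ := tf_part hβ (s := s) hM hy hx
  have key : (∫ z in Ioo (0:ℝ) (x + y), tf M s z * betaOf bs z x y) =
      (∫ z in Ioo (0:ℝ) x, tf M s z * bs z x y) + ∫ z in Ioo (0:ℝ) y, tf M s z * bs z y x := by
    have e : (fun z => tf M s z * betaOf bs z x y) = fun z =>
        (Ioo (0:ℝ) x).indicator (fun z => tf M s z * bs z x y) z +
        (Ioo (0:ℝ) y).indicator (fun z => tf M s z * bs z y x) z := by
      funext z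
      simp only [betaOf, indicator, mul_add, mul_ite, mul_zero]
    have s1 : Ioo (0:ℝ) (x + y) ∩ Ioo (0:ℝ) x = Ioo 0 x :=
      inter_eq_right.2 (Ioo_subset_Ioo_right (by linarith))
    have s2 : Ioo (0:ℝ) (x + y) ∩ Ioo (0:ℝ) y = Ioo 0 y :=
      inter_eq_right.2 (Ioo_subset_Ioo_right (by linarith))
    rw [e, integral_add, setIntegral_indicator measurableSet_Ioo,
      setIntegral_indicator measurableSet_Ioo, s1, s2]
    · exact ((integrable_indicator_iff measurableSet_Ioo).2 i1).integrableOn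
    · exact ((integrable_indicator_iff measurableSet_Ioo).2 i2).integrableOn
  unfold Upsilon
  rw [key]
  linarith

/-- Stochastic domination: comparison on open rays implies comparison of integrals of monotone
functions. -/
lemma dom_lintegral {μ ν : Measure ℝ} [NullSingletonClass μ] [NullSingletonClass ν]
    (h : ∀ r : ℝ, μ (Ioi r) ≤ ν (Ioi r)) (huniv : μ univ ≤ ν univ)
    {f : ℝ → ℝ} (hf0 : ∀ x, 0 ≤ f x) (hf : Monotone f) :
    ∫⁻ x, ENNReal.ofReal (f x) ∂μ ≤ ∫⁻ x, ENNReal.ofReal (f x) ∂ν := by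
  rw [lintegral_eq_lintegral_meas_lt μ (Eventually.of_forall hf0) hf.measurable.aemeasurable,
    lintegral_eq_lintegral_meas_lt ν (Eventually.of_forall hf0) hf.measurable.aemeasurable]
  refine lintegral_mono fun c => ?_
  set S := {a | c < f a} with hS
  show μ S ≤ ν S
  have hup : ∀ a ∈ S, ∀ b, a ≤ b → b ∈ S := fun a ha b hab => lt_of_lt_of_le ha (hf hab)
  rcases S.eq_empty_or_nonempty with he | hne
  · simp [he]
  by_cases hb : BddBelow S
  · have h1 : S ⊆ Ici (sInf S) := fun a ha => csInf_le hb ha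
    have h2 : Ioi (sInf S) ⊆ S := by
      intro a ha
      obtain ⟨b, hbS, hba⟩ := exists_lt_of_csInf_lt hne ha
      exact hup b hbS a hba.le
    calc μ S ≤ μ (Ici (sInf S)) := measure_mono h1
      _ = μ (Ioi (sInf S)) := measure_congr Ioi_ae_eq_Ici.symm
      _ ≤ ν (Ioi (sInf S)) := h _
      _ ≤ ν S := measure_mono h2
  · have : S = univ := by
      rw [eq_univ_iff_forall]
      intro a
      rw [not_bddBelow_iff] at hb
      obtain ⟨b, hbS, hba⟩ := hb a
      exact hup b hbS a hba.le
    rw [this]; exact huniv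

/-- The weighted measure `x v(x) dx` on `(0,∞)`. -/
def massMeas (v : ℝ → ℝ) : Measure ℝ :=
  (volume.restrict (Ioi (0:ℝ))).withDensity fun x => ENNReal.ofReal (x * v x)

instance massMeas_noAtoms (v : ℝ → ℝ) : NullSingletonClass (massMeas v) := by
  refine ⟨fun x => ?_⟩
  exact withDensity_absolutelyContinuous _ _ (measure_singleton x)

lemma massMeas_Ioi (v : ℝ → ℝ) {r : ℝ} (hr : 0 ≤ r) (hv : ∀ x ∈ Ioi (0:ℝ), 0 ≤ v x)
    (hi : IntegrableOn (fun x => x * v x) (Ioi 0)) :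
    massMeas v (Ioi r) = ENNReal.ofReal (∫ x in Ioi r, x * v x) := by
  unfold massMeas
  have hsub : Ioi r ⊆ Ioi (0:ℝ) := Ioi_subset_Ioi hr
  rw [withDensity_apply _ measurableSet_Ioi, Measure.restrict_restrict measurableSet_Ioi,
    inter_eq_left.2 hsub, ofReal_integral_eq_lintegral_ofReal (hi.mono_set hsub)]
  filter_upwards [ae_restrict_mem measurableSet_Ioi] with x hx
  exact mul_nonneg (hsub hx).le (hv x (hsub hx))

lemma massMeas_of_nonpos (v : ℝ → ℝ) {S : Set ℝ} (hS : MeasurableSet S) (hr : Ioi (0:ℝ) ⊆ S) :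
    massMeas v S = massMeas v (Ioi 0) := by
  unfold massMeas
  rw [withDensity_apply _ measurableSet_Ioi, withDensity_apply _ hS,
    Measure.restrict_restrict measurableSet_Ioi, Measure.restrict_restrict hS,
    inter_eq_right.2 hr, inter_self]

lemma moment_eq {v : ℝ → ℝ} (hvm : Measurable v) (hv : ∀ x ∈ Ioi (0:ℝ), 0 ≤ v x)
    (k : ℝ) {a : ℝ} (ha : 0 ≤ a) :
    ∫⁻ x, ENNReal.ofReal ((Ioi a).indicator (fun x => x ^ (k - 1)) x) ∂(massMeas v) =
      ∫⁻ x in Ioi a, ENNReal.ofReal (x ^ k * v x) := by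
  have hsub : Ioi a ⊆ Ioi (0:ℝ) := Ioi_subset_Ioi ha
  have hm : Measurable fun x : ℝ => x ^ (k - 1) := by fun_prop
  unfold massMeas
  rw [lintegral_withDensity_eq_lintegral_mul _ (by fun_prop)
    (hm.indicator measurableSet_Ioi).ennreal_ofReal]
  have e : ∀ x, ((fun x => ENNReal.ofReal (x * v x)) * fun x =>
      ENNReal.ofReal ((Ioi a).indicator (fun x => x ^ (k - 1)) x)) x =
      (Ioi a).indicator (fun x => ENNReal.ofReal (x ^ k * v x)) x := by
    intro x
    by_cases hx : x ∈ Ioi a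
    · have hx0 : 0 < x := hsub hx
      simp only [Pi.mul_apply, indicator_of_mem hx]
      rw [← ENNReal.ofReal_mul (mul_nonneg hx0.le (hv x hx0))]
      congr 1
      rw [Real.rpow_sub_one hx0.ne']
      field_simp
    · simp only [Pi.mul_apply, indicator_of_notMem hx, ENNReal.ofReal_zero, mul_zero]
  rw [lintegral_congr e, lintegral_indicator measurableSet_Ioi,
    Measure.restrict_restrict measurableSet_Ioi, inter_eq_left.2 hsub]

/-- Tail control of superlinear moments for mass-conserving weak
solutions with a kernel `Φ̄ ≤ Φ`. -/
theorem tail_moment_control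
    (k₀ l₁ l₂ : ℝ) (hk₀ : k₀ ∈ Ioo (0:ℝ) 1)
    (bs : ℝ → ℝ → ℝ → ℝ) (hβ : FragKernel k₀ bs)
    (hl₁ : k₀ ≤ l₁) (hl₁₂ : l₁ ≤ l₂) (hl₂ : l₂ ≤ 1)
    (Kb : ℝ → ℝ → ℝ) (hKm : Measurable fun q : ℝ × ℝ => Kb q.1 q.2)
    (hKnn : ∀ x₁ x₂ : ℝ, 0 ≤ Kb x₁ x₂) (hKsymm : ∀ x₁ x₂ : ℝ, Kb x₁ x₂ = Kb x₂ x₁)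
    (hKle : ∀ x₁ ∈ Ioi (0:ℝ), ∀ x₂ ∈ Ioi (0:ℝ), Kb x₁ x₂ ≤ Phi l₁ l₂ x₁ x₂)
    (uin : ℝ → ℝ) (hmeas : Measurable uin) (hnn : ∀ x : ℝ, 0 ≤ uin x)
    (hXk₀ : MemXk k₀ uin) (hX1 : MemXk 1 uin)
    (T : ℝ≥0∞) (hT : 0 < T)
    (u : ℝ → ℝ → ℝ) (hu : IsWeakSolution k₀ bs Kb uin T u)
    (hmc : MassConserving uin T u)
    (hint : ∀ t : ℝ, 0 < t → ENNReal.ofReal t < T →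
      MeasureTheory.IntegrableOn
        (fun q : ℝ × ℝ × ℝ =>
          (q.2.1 + q.2.2) * Kb q.2.1 q.2.2 * u q.1 q.2.1 * u q.1 q.2.2)
        (Ioo (0:ℝ) t ×ˢ (Ioi (0:ℝ) ×ˢ Ioi (0:ℝ))))
    (k : ℝ) (hk : 1 ≤ k) (hXk : MemXk k uin) :
    (∀ t : ℝ, 0 ≤ t → ENNReal.ofReal t < T → ∀ x₁ ∈ Ioi (0:ℝ),
      (∫ x₂ in Ioi x₁, x₂ ^ k * u t x₂) ≤ ∫ x₂ in Ioi x₁, x₂ ^ k * uin x₂) ∧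
    (∀ t : ℝ, 0 ≤ t → ENNReal.ofReal t < T → Mk k (u t) ≤ Mk k uin) := by
  have hX1' : IntegrableOn (fun x => x * uin x) (Ioi 0) := by
    have := hX1
    unfold MemXk at this
    simpa only [Real.rpow_one] using this
  suffices H : ∀ t : ℝ, 0 ≤ t → ENNReal.ofReal t < T → ∀ a : ℝ, 0 ≤ a →
      (∫ x₂ in Ioi a, x₂ ^ k * u t x₂) ≤ ∫ x₂ in Ioi a, x₂ ^ k * uin x₂ from
    ⟨fun t ht htT a ha => H t ht htT a (le_of_lt ha), fun t ht htT => H t ht htT 0 le_rfl⟩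
  intro t ht htT a ha
  have hum : Measurable (u t) := hu.meas.of_uncurry_left
  have hunn := hu.nonneg t ht htT
  rcases eq_or_lt_of_le ht with h0 | htpos
  · subst h0
    refine le_of_eq (setIntegral_congr_fun measurableSet_Ioi fun x hx => ?_)
    show x ^ k * u 0 x = x ^ k * uin x
    rw [hu.init x (lt_of_le_of_lt ha hx)]
  have hut : IntegrableOn (fun x => x * u t x) (Ioi 0) := by
    obtain ⟨C, hC⟩ := hu.massBdd
    refine ⟨(measurable_id.mul hum).aestronglyMeasurable, ?_⟩
    rw [hasFiniteIntegral_iff_ofReal]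
    · exact lt_of_le_of_lt (hC t ht htT) ENNReal.ofReal_lt_top
    · filter_upwards [ae_restrict_mem measurableSet_Ioi] with x hx
      exact mul_nonneg (le_of_lt hx) (hunn x hx)
  have hmass : ∫ x in Ioi (0:ℝ), x * u t x = ∫ x in Ioi (0:ℝ), x * uin x := by
    have := hmc t ht htT
    unfold Mk at this
    simpa only [Real.rpow_one] using this
  have tfint : ∀ (M s : ℝ) (v : ℝ → ℝ), Measurable v → (∀ x ∈ Ioi (0:ℝ), 0 ≤ v x) →
      IntegrableOn (fun x => x * v x) (Ioi 0) →
      IntegrableOn (fun x => tf M s x * v x) (Ioi 0) := by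
    intro M s v hvm hv hi
    refine Integrable.mono' hi ((tf_meas M s).mul hvm).aestronglyMeasurable ?_
    filter_upwards [ae_restrict_mem measurableSet_Ioi] with z hz
    rw [Real.norm_eq_abs, abs_of_nonneg (mul_nonneg (tf_nonneg _ _ _) (hv z hz))]
    exact mul_le_mul_of_nonneg_right (tf_le (le_of_lt hz)) (hv z hz)
  have step : ∀ r s : ℝ, 0 < r → r < s →
      ∫ x in Ioi s, x * u t x ≤ ∫ x in Ioi r, x * uin x := by
    intro r s hr hrs
    obtain ⟨M, hM⟩ : ∃ M, M = r / (s - r) := ⟨_, rfl⟩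
    have hsr : 0 < s - r := by linarith
    have hM0 : 0 ≤ M := by rw [hM]; positivity
    have hMr : M * (s - r) = r := by rw [hM]; field_simp
    have hs : 0 < s := by linarith
    have hw := hu.weak t htpos htT (tf M s) (tf_holder hk₀ hM0 hs.le)
      ⟨s, fun x hx => tf_bdd hM0 hs.le hx⟩
    have hpos : 0 ≤ ∫ τ in Ioo (0:ℝ) t, ∫ x₁ in Ioi (0:ℝ), ∫ x₂ in Ioi (0:ℝ),
        Upsilon bs (tf M s) x₁ x₂ * Kb x₁ x₂ * u τ x₁ * u τ x₂ := by
      refine setIntegral_nonneg measurableSet_Ioo fun τ hτ => ?_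
      refine setIntegral_nonneg measurableSet_Ioi fun x hx => ?_
      refine setIntegral_nonneg measurableSet_Ioi fun y hy => ?_
      have hτT : ENNReal.ofReal τ < T := lt_of_le_of_lt (ENNReal.ofReal_le_ofReal hτ.2.le) htT
      have n := hu.nonneg τ hτ.1.le hτT
      exact mul_nonneg (mul_nonneg (mul_nonneg (upsilon_nonneg hβ hM0 hx hy) (hKnn _ _))
        (n x hx)) (n y hy)
    have i1 := tfint M s (u t) hum hunn hut
    have i2 := tfint M s uin hmeas (fun x _ => hnn x) hX1'
    have l1 : ∫ x in Ioi s, x * u t x ≤ ∫ x in Ioi (0:ℝ), (x * u t x - tf M s x * u t x) := by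
      rw [← inter_eq_right.2 (Ioi_subset_Ioi hs.le), ← setIntegral_indicator measurableSet_Ioi]
      refine setIntegral_mono_on (hut.indicator measurableSet_Ioi) (hut.sub i1)
        measurableSet_Ioi fun x hx => ?_
      by_cases hxs : x ∈ Ioi s
      · rw [indicator_of_mem hxs, tf_zero hM0 (le_of_lt hxs)]; simp
      · rw [indicator_of_notMem hxs, ← sub_mul]
        exact mul_nonneg (sub_nonneg.2 (tf_le (le_of_lt hx))) (hunn x hx)
    have l2 : ∫ x in Ioi (0:ℝ), (x * uin x - tf M s x * uin x) ≤ ∫ x in Ioi r, x * uin x := by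
      rw [← inter_eq_right.2 (Ioi_subset_Ioi hr.le), ← setIntegral_indicator measurableSet_Ioi]
      refine setIntegral_mono_on (hX1'.sub i2) (hX1'.indicator measurableSet_Ioi)
        measurableSet_Ioi fun x hx => ?_
      by_cases hxs : x ∈ Ioi r
      · rw [indicator_of_mem hxs]
        have := mul_nonneg (tf_nonneg M s x) (hnn x)
        linarith
      · rw [indicator_of_notMem hxs, tf_eq hM0 hMr (le_of_lt hx) (not_lt.1 hxs)]; simp
    rw [integral_sub hut i1] at l1
    rw [integral_sub hX1' i2] at l2
    linarith
  have h0 : massMeas (u t) (Ioi 0) = massMeas uin (Ioi 0) := by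
    rw [massMeas_Ioi _ le_rfl hunn hut, massMeas_Ioi _ le_rfl (fun x _ => hnn x) hX1', hmass]
  have tail : ∀ r : ℝ, massMeas (u t) (Ioi r) ≤ massMeas uin (Ioi r) := by
    intro r
    rcases le_or_gt r 0 with hr | hr
    · rw [massMeas_of_nonpos _ measurableSet_Ioi (Ioi_subset_Ioi hr),
        massMeas_of_nonpos _ measurableSet_Ioi (Ioi_subset_Ioi hr), h0]
    · have hU : Ioi r = ⋃ n : ℕ, Ioi (r + 1 / ((n:ℝ) + 1)) := by
        ext x
        simp only [mem_Ioi, mem_iUnion]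
        constructor
        · intro hx
          obtain ⟨n, hn⟩ := exists_nat_one_div_lt (sub_pos.2 hx)
          exact ⟨n, by linarith⟩
        · rintro ⟨n, hn⟩
          have : 0 < 1 / ((n:ℝ) + 1) := by positivity
          linarith
      have hmono : Monotone fun n : ℕ => Ioi (r + 1 / ((n:ℝ) + 1)) := by
        intro m n hmn
        apply Ioi_subset_Ioi
        have := Nat.one_div_le_one_div (α := ℝ) hmn
        linarith
      conv_lhs => rw [hU]
      rw [hmono.measure_iUnion]
      refine iSup_le fun n => ?_
      have hp : 0 < 1 / ((n:ℝ) + 1) := by positivity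
      rw [massMeas_Ioi _ (by linarith) hunn hut, massMeas_Ioi _ hr.le (fun x _ => hnn x) hX1']
      exact ENNReal.ofReal_le_ofReal (step _ _ hr (by linarith))
  have huniv : massMeas (u t) univ ≤ massMeas uin univ := by
    rw [massMeas_of_nonpos _ MeasurableSet.univ (subset_univ _),
      massMeas_of_nonpos _ MeasurableSet.univ (subset_univ _), h0]
  have hf0 : ∀ x, 0 ≤ (Ioi a).indicator (fun x : ℝ => x ^ (k - 1)) x := by
    intro x
    exact indicator_nonneg (fun y hy => Real.rpow_nonneg (le_of_lt (lt_of_le_of_lt ha hy)) _) x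
  have hfm : Monotone ((Ioi a).indicator (fun x : ℝ => x ^ (k - 1))) := by
    intro x y hxy
    by_cases hx : x ∈ Ioi a
    · have hy : y ∈ Ioi a := lt_of_lt_of_le hx hxy
      rw [indicator_of_mem hx, indicator_of_mem hy]
      exact Real.rpow_le_rpow (le_of_lt (lt_of_le_of_lt ha hx)) hxy (by linarith)
    · rw [indicator_of_notMem hx]; exact hf0 y
  have hdom := dom_lintegral tail huniv hf0 hfm
  rw [moment_eq hum hunn k ha, moment_eq hmeas (fun x _ => hnn x) k ha] at hdom
  have hIk : IntegrableOn (fun x => x ^ k * uin x) (Ioi a) := hXk.mono_set (Ioi_subset_Ioi ha)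
  have hmk : Measurable fun x : ℝ => x ^ k := by fun_prop
  have n2 : ∀ v : ℝ → ℝ, (∀ x ∈ Ioi (0:ℝ), 0 ≤ v x) →
      0 ≤ᵐ[volume.restrict (Ioi a)] fun x => x ^ k * v x := by
    intro v hv
    filter_upwards [ae_restrict_mem measurableSet_Ioi] with x hx
    have hx0 : 0 < x := lt_of_le_of_lt ha hx
    exact mul_nonneg (Real.rpow_nonneg hx0.le _) (hv x hx0)
  rw [integral_eq_lintegral_of_nonneg_ae (n2 _ hunn) (hmk.mul hum).aestronglyMeasurable,
    integral_eq_lintegral_of_nonneg_ae (n2 _ fun x _ => hnn x)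
      (hmk.mul hmeas).aestronglyMeasurable]
  refine ENNReal.toReal_mono ?_ hdom
  rw [← ofReal_integral_eq_lintegral_ofReal hIk (n2 _ fun x _ => hnn x)]
  exact ENNReal.ofReal_ne_top

end
end

section
/- Let β be a fragment daughter distribution satisfying the mass-transfer form and local mass conservation. Let k ≥ 1, 0 < L₁ < L₂, and define ς : [0,∞) → ℝ by ς(x) = x^k for x ∈ (L₁,L₂), ς(x) = x·L₂^{k−1} for x ≥ L₂, and ς(x) = 0 for x ∈ [0,L₁]. Then Υ_ς(x₁,x₂) ≤ 0 for all (x₁,x₂) ∈ (0,∞)². -/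
open MeasureTheory Set Filter
open scoped ENNReal

noncomputable section

/-- Nonpositivity of `Υ_ς` for the truncated superlinear test function. -/
theorem upsilon_nonpos
    (bs : ℝ → ℝ → ℝ → ℝ)
    (hβm : Measurable fun q : ℝ × ℝ × ℝ => bs q.1 q.2.1 q.2.2)
    (hβnn : ∀ x₃ x₁ x₂ : ℝ, 0 ≤ bs x₃ x₁ x₂)
    (hmass : ∀ x₁ ∈ Ioi (0:ℝ), ∀ x₂ ∈ Ioi (0:ℝ),
      ∫ x₃ in Ioo (0:ℝ) x₁, x₃ * bs x₃ x₁ x₂ = x₁)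
    (k L₁ L₂ : ℝ) (hk : 1 ≤ k) (hL₁ : 0 < L₁) (hL : L₁ < L₂)
    (ς : ℝ → ℝ)
    (hς : ∀ x : ℝ, ς x = if x ≤ L₁ then 0 else if x < L₂ then x ^ k else x * L₂ ^ (k - 1)) :
    ∀ x₁ ∈ Ioi (0:ℝ), ∀ x₂ ∈ Ioi (0:ℝ), Upsilon bs ς x₁ x₂ ≤ 0 := by
  intro x₁ hx₁ x₂ hx₂
  have hx₁' : 0 < x₁ := hx₁
  have hx₂' : 0 < x₂ := hx₂
  have hL₂ : 0 < L₂ := hL₁.trans hL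
  -- the slope `g(x) = ς(x)/x` is nonnegative and nondecreasing
  have hnn : ∀ x : ℝ, 0 < x → 0 ≤ ς x := by
    intro x hx
    rw [hς x]
    split_ifs <;> positivity
  have key : ∀ x y : ℝ, 0 < x → x ≤ y → ς x ≤ ς y / y * x := by
    intro x y hx hxy
    have hy : 0 < y := hx.trans_le hxy
    have hpow : ∀ z : ℝ, 0 < z → z ^ k = z * z ^ (k - 1) := by
      intro z hz
      rw [Real.rpow_sub_one hz.ne']
      field_simp
    by_cases h1 : x ≤ L₁
    · have h0 : ς x = 0 := by rw [hς x, if_pos h1]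
      rw [h0]
      exact mul_nonneg (div_nonneg (hnn y hy) hy.le) hx.le
    · have h1' : ¬ y ≤ L₁ := fun h => h1 (hxy.trans h)
      rw [hς x, hς y, if_neg h1, if_neg h1']
      have hk1 : 0 ≤ k - 1 := by linarith
      by_cases h2 : x < L₂
      · rw [if_pos h2, hpow x hx]
        by_cases h3 : y < L₂
        · rw [if_pos h3, hpow y hy, mul_div_cancel_left₀ _ hy.ne', mul_comm]
          exact mul_le_mul_of_nonneg_right (Real.rpow_le_rpow hx.le hxy hk1) hx.le
        · rw [if_neg h3, mul_div_cancel_left₀ _ hy.ne', mul_comm]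
          exact mul_le_mul_of_nonneg_right (Real.rpow_le_rpow hx.le h2.le hk1) hx.le
      · have h3 : ¬ y < L₂ := fun h => h2 (hxy.trans_lt h)
        rw [if_neg h2, if_neg h3, mul_div_cancel_left₀ _ hy.ne', mul_comm]
  -- one-fragment data
  have part : ∀ a b : ℝ, 0 < a → 0 < b →
      IntegrableOn ((Ioo (0:ℝ) a).indicator fun x => ς a / a * (x * bs x a b)) (Ioo 0 (a + b)) ∧
      ∫ x in Ioo (0:ℝ) (a + b), (Ioo (0:ℝ) a).indicator (fun x => ς a / a * (x * bs x a b)) x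
        = ς a := by
    intro a b ha hb
    have hm := hmass a ha b hb
    have hint : IntegrableOn (fun x => x * bs x a b) (Ioo 0 a) := by
      by_contra h
      rw [integral_undef h] at hm
      exact ha.ne hm
    constructor
    · exact ((integrable_indicator_iff measurableSet_Ioo).2 (hint.const_mul _)).integrableOn
    · rw [setIntegral_indicator measurableSet_Ioo,
        inter_eq_right.2 (Ioo_subset_Ioo_right (by linarith)), integral_const_mul, hm,
        div_mul_cancel₀ _ ha.ne']
  obtain ⟨i1, e1⟩ := part x₁ x₂ hx₁' hx₂'
  obtain ⟨i2, e2⟩ := part x₂ x₁ hx₂' hx₁'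
  rw [add_comm x₂ x₁] at i2 e2
  have hle : ∫ x₃ in Ioo (0:ℝ) (x₁ + x₂), ς x₃ * betaOf bs x₃ x₁ x₂ ≤
      ∫ x in Ioo (0:ℝ) (x₁ + x₂),
        ((Ioo (0:ℝ) x₁).indicator (fun x => ς x₁ / x₁ * (x * bs x x₁ x₂)) x +
          (Ioo (0:ℝ) x₂).indicator (fun x => ς x₂ / x₂ * (x * bs x x₂ x₁)) x) := by
    refine integral_mono_of_nonneg ?_ (i1.add i2) ?_
    · filter_upwards [ae_restrict_mem measurableSet_Ioo] with x hx
      refine mul_nonneg (hnn x hx.1) ?_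
      unfold betaOf
      refine add_nonneg ?_ ?_ <;> split_ifs <;> simp [hβnn]
    · filter_upwards [ae_restrict_mem measurableSet_Ioo] with x hx
      have one : ∀ a b : ℝ, ς x * (if x ∈ Ioo (0:ℝ) a then bs x a b else 0) ≤
          (Ioo (0:ℝ) a).indicator (fun x => ς a / a * (x * bs x a b)) x := by
        intro a b
        by_cases h : x ∈ Ioo (0:ℝ) a
        · rw [if_pos h, indicator_of_mem h, ← mul_assoc]
          exact mul_le_mul_of_nonneg_right (key x a h.1 h.2.le) (hβnn _ _ _)
        · rw [if_neg h, indicator_of_notMem h, mul_zero]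
      unfold betaOf
      rw [mul_add]
      exact add_le_add (one x₁ x₂) (one x₂ x₁)
  rw [integral_add i1 i2, e1, e2] at hle
  unfold Upsilon
  linarith


end
end

section
/- Let k₀ ∈ (0,1), let β be a fragment daughter distribution satisfying the mass-transfer form, local mass conservation, and the non-integrability bound at p = 1 with constant E_{k₀,1} ≥ 1, and let Φ be the collision kernel with exponents k₀ ≤ λ₁ ≤ λ₂ ≤ 1. Set w(x) := max{x^{k₀}, x^{1+k₀}} for x > 0. Then for all (x₁,x₂) ∈ (0,∞)², Φ(x₁,x₂)·[∫₀^{x₁+x₂} w(x₃) β(x₃,x₁,x₂) dx₃ + w(x₁) − w(x₂)] ≤ 8 E_{k₀,1} (x₁^{k₀} + x₁^{1+k₀+λ₂}) w(x₂). -/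
open MeasureTheory Set Filter
open scoped ENNReal

noncomputable section

lemma A_bound {k₀ E₁ x : ℝ} (hk₀ : k₀ ∈ Ioo (0:ℝ) 1) (hx : 0 < x) (g : ℝ → ℝ)
    (hgm : Measurable g) (hg : ∀ y, 0 ≤ g y)
    (hmass : ∫ y in Ioo (0:ℝ) x, y * g y = x)
    (hb : ∫ y in Ioo (0:ℝ) x, y ^ k₀ * g y ≤ E₁ * x ^ k₀)
    (hi : IntegrableOn (fun y => max (y ^ k₀) (y ^ (1 + k₀)) * g y) (Ioo 0 x)) :
    ∫ y in Ioo (0:ℝ) x, max (y ^ k₀) (y ^ (1 + k₀)) * g y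
      ≤ max (x ^ k₀) (x ^ (1 + k₀)) + E₁ * x ^ k₀ := by
  have h1 : IntegrableOn (fun y => y * g y) (Ioo 0 x) := by
    by_contra h
    rw [integral_undef h] at hmass
    exact hx.ne hmass
  have h2 : IntegrableOn (fun y => y ^ k₀ * g y) (Ioo 0 x) := by
    refine Integrable.mono' hi ?_ ?_
    · exact Measurable.aestronglyMeasurable (by fun_prop)
    · refine (ae_restrict_iff' measurableSet_Ioo).2 (ae_of_all _ fun y hy => ?_)
      have := Real.rpow_nonneg hy.1.le k₀
      rw [Real.norm_of_nonneg (mul_nonneg this (hg y))]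
      exact mul_le_mul_of_nonneg_right (le_max_left _ _) (hg y)
  have h3 : ∫ y in Ioo (0:ℝ) x, max (y ^ k₀) (y ^ (1 + k₀)) * g y
      ≤ ∫ y in Ioo (0:ℝ) x, (y ^ k₀ * g y + x ^ k₀ * (y * g y)) := by
    refine setIntegral_mono_on hi (h2.add (h1.const_mul _)) measurableSet_Ioo fun y hy => ?_
    have a := Real.rpow_nonneg hy.1.le k₀
    have b := Real.rpow_nonneg hx.le k₀
    have c : y ^ (1 + k₀) = y * y ^ k₀ := by
      rw [Real.rpow_add hy.1, Real.rpow_one]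
    have d : y ^ k₀ ≤ x ^ k₀ := Real.rpow_le_rpow hy.1.le hy.2.le hk₀.1.le
    have e : max (y ^ k₀) (y ^ (1 + k₀)) ≤ y ^ k₀ + x ^ k₀ * y := by
      rw [c]
      have := mul_le_mul_of_nonneg_left d hy.1.le
      have := mul_nonneg b hy.1.le
      exact max_le (by linarith) (by linarith)
    have := mul_le_mul_of_nonneg_right e (hg y)
    linarith
  rw [integral_add h2 (h1.const_mul _), integral_const_mul, hmass] at h3
  have c : x ^ (1 + k₀) = x ^ k₀ * x := by
    rw [Real.rpow_add hx, Real.rpow_one, mul_comm]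
  have := le_max_right (x ^ k₀) (x ^ (1 + k₀))
  linarith

lemma I_bound {k₀ E₁ s t : ℝ} (hk₀ : k₀ ∈ Ioo (0:ℝ) 1) (hE : 1 ≤ E₁) (hs : 0 < s) (ht : 0 < t)
    (g h : ℝ → ℝ)
    (hgm : Measurable g) (hg : ∀ y, 0 ≤ g y)
    (hgmass : ∫ y in Ioo (0:ℝ) s, y * g y = s)
    (hgb : ∫ y in Ioo (0:ℝ) s, y ^ k₀ * g y ≤ E₁ * s ^ k₀)
    (hhm : Measurable h) (hh : ∀ y, 0 ≤ h y)
    (hhmass : ∫ y in Ioo (0:ℝ) t, y * h y = t)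
    (hhb : ∫ y in Ioo (0:ℝ) t, y ^ k₀ * h y ≤ E₁ * t ^ k₀) :
    ∫ y in Ioo (0:ℝ) (s + t), max (y ^ k₀) (y ^ (1 + k₀)) *
        ((if y ∈ Ioo (0:ℝ) s then g y else 0) + (if y ∈ Ioo (0:ℝ) t then h y else 0))
      ≤ (max (s ^ k₀) (s ^ (1 + k₀)) + E₁ * s ^ k₀) +
        (max (t ^ k₀) (t ^ (1 + k₀)) + E₁ * t ^ k₀) := by
  have ps := Real.rpow_nonneg hs.le k₀
  have pt := Real.rpow_nonneg ht.le k₀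
  by_cases hi : IntegrableOn (fun y => max (y ^ k₀) (y ^ (1 + k₀)) *
        ((if y ∈ Ioo (0:ℝ) s then g y else 0) + (if y ∈ Ioo (0:ℝ) t then h y else 0)))
        (Ioo 0 (s + t))
  swap
  · rw [integral_undef hi]
    have := le_max_left (s ^ k₀) (s ^ (1 + k₀))
    have := le_max_left (t ^ k₀) (t ^ (1 + k₀))
    positivity
  set w : ℝ → ℝ := fun y => max (y ^ k₀) (y ^ (1 + k₀)) with hw
  have hwm : Measurable w := by fun_prop
  have hw0 : ∀ y, 0 < y → 0 ≤ w y := fun y hy => le_max_of_le_left (Real.rpow_nonneg hy.le k₀)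
  have ss : Ioo 0 s ⊆ Ioo 0 (s + t) := Ioo_subset_Ioo_right (by linarith)
  have st : Ioo 0 t ⊆ Ioo 0 (s + t) := Ioo_subset_Ioo_right (by linarith)
  have i1 : IntegrableOn (fun y => w y * g y) (Ioo 0 s) := by
    refine Integrable.mono' (hi.mono_set ss) (hwm.mul hgm).aestronglyMeasurable ?_
    refine (ae_restrict_iff' measurableSet_Ioo).2 (ae_of_all _ fun y hy => ?_)
    rw [Real.norm_of_nonneg (mul_nonneg (hw0 y hy.1) (hg y)), if_pos hy]
    refine mul_le_mul_of_nonneg_left ?_ (hw0 y hy.1)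
    split_ifs <;> linarith [hh y]
  have i2 : IntegrableOn (fun y => w y * h y) (Ioo 0 t) := by
    refine Integrable.mono' (hi.mono_set st) (hwm.mul hhm).aestronglyMeasurable ?_
    refine (ae_restrict_iff' measurableSet_Ioo).2 (ae_of_all _ fun y hy => ?_)
    rw [Real.norm_of_nonneg (mul_nonneg (hw0 y hy.1) (hh y)), if_pos hy]
    refine mul_le_mul_of_nonneg_left ?_ (hw0 y hy.1)
    split_ifs <;> linarith [hg y]
  have b1 := A_bound hk₀ hs g hgm hg hgmass hgb i1
  have b2 := A_bound hk₀ ht h hhm hh hhmass hhb i2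
  have j1 := ((integrable_indicator_iff measurableSet_Ioo).2 i1).integrableOn (s := Ioo 0 (s + t))
  have j2 := ((integrable_indicator_iff measurableSet_Ioo).2 i2).integrableOn (s := Ioo 0 (s + t))
  have key : ∫ y in Ioo (0:ℝ) (s + t), w y *
        ((if y ∈ Ioo (0:ℝ) s then g y else 0) + (if y ∈ Ioo (0:ℝ) t then h y else 0))
      = (∫ y in Ioo (0:ℝ) s, w y * g y) + ∫ y in Ioo (0:ℝ) t, w y * h y := by
    have e1 : ∫ y in Ioo (0:ℝ) s, w y * g y =
        ∫ y in Ioo (0:ℝ) (s + t), (Ioo 0 s).indicator (fun y => w y * g y) y := by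
      rw [setIntegral_indicator measurableSet_Ioo, inter_eq_self_of_subset_right ss]
    have e2 : ∫ y in Ioo (0:ℝ) t, w y * h y =
        ∫ y in Ioo (0:ℝ) (s + t), (Ioo 0 t).indicator (fun y => w y * h y) y := by
      rw [setIntegral_indicator measurableSet_Ioo, inter_eq_self_of_subset_right st]
    rw [e1, e2, ← integral_add j1 j2]
    congr 1
    funext y
    simp only [indicator]
    split_ifs <;> ring
  calc _ = _ := key
    _ ≤ _ := add_le_add b1 b2

lemma Phi_bound {l₁ l₂ s t S T : ℝ} (hs : 0 < s) (ht : 0 < t)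
    (a1 : s ^ l₁ ≤ S) (a2 : s ^ l₂ ≤ S) (b1 : t ^ l₁ ≤ T) (b2 : t ^ l₂ ≤ T) :
    Phi l₁ l₂ s t ≤ 2 * (S * T) := by
  have p1 := Real.rpow_nonneg hs.le l₁
  have p2 := Real.rpow_nonneg hs.le l₂
  have p3 := Real.rpow_nonneg ht.le l₁
  have p4 := Real.rpow_nonneg ht.le l₂
  have h1 : s ^ l₁ * t ^ l₂ ≤ S * T := mul_le_mul a1 b2 p4 (p1.trans a1)
  have h2 : t ^ l₁ * s ^ l₂ ≤ S * T := by
    rw [mul_comm]; exact mul_le_mul a2 b1 p3 (p2.trans a2)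
  unfold Phi
  linarith

lemma elem_bound {k₀ l₁ l₂ s t : ℝ} (hk₀ : k₀ ∈ Ioo (0:ℝ) 1)
    (hl₁ : k₀ ≤ l₁) (hl₁₂ : l₁ ≤ l₂) (hl₂ : l₂ ≤ 1) (hs : 0 < s) (ht : 0 < t) :
    Phi l₁ l₂ s t * (3 * max (s ^ k₀) (s ^ (1 + k₀)) + t ^ k₀) ≤
      8 * (s ^ k₀ + s ^ (1 + k₀ + l₂)) * max (t ^ k₀) (t ^ (1 + k₀)) := by
  obtain ⟨k0, k1⟩ := hk₀
  have psk := Real.rpow_pos_of_pos hs k₀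
  have psL := Real.rpow_pos_of_pos hs (1 + k₀ + l₂)
  have ps2 := Real.rpow_pos_of_pos hs l₂
  have ps1 := Real.rpow_pos_of_pos hs (1 + k₀)
  have ptk := Real.rpow_pos_of_pos ht k₀
  have pt1 := Real.rpow_pos_of_pos ht (1 + k₀)
  have esL : s ^ (1 + k₀ + l₂) = s ^ (1 + k₀) * s ^ l₂ := Real.rpow_add hs _ _
  have et1 : t ^ (1 + k₀) = t * t ^ k₀ := by rw [Real.rpow_add ht, Real.rpow_one]
  -- final combination
  have fin : ∀ S T B C W : ℝ, 0 ≤ S → 0 ≤ T → 0 ≤ B → Phi l₁ l₂ s t ≤ 2 * (S * T) →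
      3 * max (s ^ k₀) (s ^ (1 + k₀)) + t ^ k₀ ≤ 4 * B →
      (S * T) * B ≤ C * W → C ≤ s ^ k₀ + s ^ (1 + k₀ + l₂) → 0 ≤ W →
      W ≤ max (t ^ k₀) (t ^ (1 + k₀)) →
      Phi l₁ l₂ s t * (3 * max (s ^ k₀) (s ^ (1 + k₀)) + t ^ k₀) ≤
      8 * (s ^ k₀ + s ^ (1 + k₀ + l₂)) * max (t ^ k₀) (t ^ (1 + k₀)) := by
    intro S T B C W hS hT hB h1 h2 h3 h4 hW h5
    have n : 0 ≤ 3 * max (s ^ k₀) (s ^ (1 + k₀)) + t ^ k₀ := by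
      have := le_max_left (s ^ k₀) (s ^ (1 + k₀)); linarith
    have m1 := mul_le_mul h1 h2 n (by positivity)
    have m2 : C * W ≤ (s ^ k₀ + s ^ (1 + k₀ + l₂)) * max (t ^ k₀) (t ^ (1 + k₀)) :=
      mul_le_mul h4 h5 hW (by positivity)
    linarith
  rcases le_total s 1 with s1 | s1 <;> rcases le_total t 1 with t1 | t1
  · have m : max (s ^ k₀) (s ^ (1 + k₀)) = s ^ k₀ :=
      max_eq_left (Real.rpow_le_rpow_of_exponent_ge hs s1 (by linarith))
    refine fin (s ^ k₀) (t ^ k₀) 1 (s ^ k₀) (t ^ k₀) psk.le ptk.le zero_le_one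
      (Phi_bound hs ht ?_ ?_ ?_ ?_) ?_ (by linarith) (by linarith) ptk.le (le_max_left _ _)
    · exact Real.rpow_le_rpow_of_exponent_ge hs s1 (by linarith)
    · exact Real.rpow_le_rpow_of_exponent_ge hs s1 (by linarith)
    · exact Real.rpow_le_rpow_of_exponent_ge ht t1 (by linarith)
    · exact Real.rpow_le_rpow_of_exponent_ge ht t1 (by linarith)
    · rw [m]
      have := Real.rpow_le_one hs.le s1 k0.le
      have := Real.rpow_le_one ht.le t1 k0.le
      linarith
  · have m : max (s ^ k₀) (s ^ (1 + k₀)) = s ^ k₀ :=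
      max_eq_left (Real.rpow_le_rpow_of_exponent_ge hs s1 (by linarith))
    refine fin (s ^ k₀) t (t ^ k₀) (s ^ k₀) (t ^ (1 + k₀)) psk.le ht.le ptk.le
      (Phi_bound hs ht ?_ ?_ ?_ ?_) ?_ (by rw [et1]; linarith) (by linarith) pt1.le
      (le_max_right _ _)
    · exact Real.rpow_le_rpow_of_exponent_ge hs s1 (by linarith)
    · exact Real.rpow_le_rpow_of_exponent_ge hs s1 (by linarith)
    · exact Real.rpow_le_self_of_one_le t1 (by linarith)
    · exact Real.rpow_le_self_of_one_le t1 (by linarith)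
    · rw [m]
      have := Real.rpow_le_one hs.le s1 k0.le
      have := Real.one_le_rpow t1 k0.le
      linarith
  · have m : max (s ^ k₀) (s ^ (1 + k₀)) = s ^ (1 + k₀) :=
      max_eq_right (Real.rpow_le_rpow_of_exponent_le s1 (by linarith))
    refine fin (s ^ l₂) (t ^ k₀) (s ^ (1 + k₀)) (s ^ (1 + k₀ + l₂)) (t ^ k₀) ps2.le ptk.le ps1.le
      (Phi_bound hs ht ?_ le_rfl ?_ ?_) ?_ (by rw [esL]; linarith) (by linarith) ptk.le
      (le_max_left _ _)
    · exact Real.rpow_le_rpow_of_exponent_le s1 (by linarith)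
    · exact Real.rpow_le_rpow_of_exponent_ge ht t1 (by linarith)
    · exact Real.rpow_le_rpow_of_exponent_ge ht t1 (by linarith)
    · rw [m]
      have := Real.one_le_rpow s1 (z := 1 + k₀) (by linarith)
      have := Real.rpow_le_one ht.le t1 k0.le
      linarith
  · have m : max (s ^ k₀) (s ^ (1 + k₀)) = s ^ (1 + k₀) :=
      max_eq_right (Real.rpow_le_rpow_of_exponent_le s1 (by linarith))
    refine fin (s ^ l₂) t (s ^ (1 + k₀) * t ^ k₀) (s ^ (1 + k₀ + l₂)) (t ^ (1 + k₀)) ps2.le ht.le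
      (by positivity)
      (Phi_bound hs ht ?_ le_rfl ?_ ?_) ?_ (by rw [esL, et1]; apply le_of_eq; ring)
      (by linarith) pt1.le (le_max_right _ _)
    · exact Real.rpow_le_rpow_of_exponent_le s1 (by linarith)
    · exact Real.rpow_le_self_of_one_le t1 (by linarith)
    · exact Real.rpow_le_self_of_one_le t1 (by linarith)
    · rw [m]
      have a := Real.one_le_rpow s1 (z := 1 + k₀) (by linarith)
      have b := Real.one_le_rpow t1 k0.le
      nlinarith [mul_le_mul_of_nonneg_left b ps1.le, mul_le_mul_of_nonneg_right a ptk.le]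

/-- The pointwise bound on the quantity `Q` appearing in the uniqueness
proof, with the weight `w(x) = max{x^{k₀}, x^{1+k₀}}`. -/
theorem Q_bound
    (k₀ l₁ l₂ E₁ : ℝ) (hk₀ : k₀ ∈ Ioo (0:ℝ) 1)
    (hl₁ : k₀ ≤ l₁) (hl₁₂ : l₁ ≤ l₂) (hl₂ : l₂ ≤ 1) (hE₁ : 1 ≤ E₁)
    (bs : ℝ → ℝ → ℝ → ℝ)
    (hβm : Measurable fun q : ℝ × ℝ × ℝ => bs q.1 q.2.1 q.2.2)
    (hβnn : ∀ x₃ x₁ x₂ : ℝ, 0 ≤ bs x₃ x₁ x₂)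
    (hmass : ∀ x₁ ∈ Ioi (0:ℝ), ∀ x₂ ∈ Ioi (0:ℝ),
      ∫ x₃ in Ioo (0:ℝ) x₁, x₃ * bs x₃ x₁ x₂ = x₁)
    (hb : ∀ x₁ ∈ Ioi (0:ℝ), ∀ x₂ ∈ Ioi (0:ℝ),
      ∫ x₃ in Ioo (0:ℝ) x₁, x₃ ^ k₀ * bs x₃ x₁ x₂ ≤ E₁ * x₁ ^ k₀) :
    ∀ x₁ ∈ Ioi (0:ℝ), ∀ x₂ ∈ Ioi (0:ℝ),
      Phi l₁ l₂ x₁ x₂ *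
        ((∫ x₃ in Ioo (0:ℝ) (x₁ + x₂),
            max (x₃ ^ k₀) (x₃ ^ (1 + k₀)) * betaOf bs x₃ x₁ x₂) +
          max (x₁ ^ k₀) (x₁ ^ (1 + k₀)) - max (x₂ ^ k₀) (x₂ ^ (1 + k₀))) ≤
        8 * E₁ * (x₁ ^ k₀ + x₁ ^ (1 + k₀ + l₂)) * max (x₂ ^ k₀) (x₂ ^ (1 + k₀)) := by
  intro s hs t ht
  have hs' : 0 < s := hs
  have ht' : 0 < t := ht
  have hI := I_bound hk₀ hE₁ hs' ht' (fun y => bs y s t) (fun y => bs y t s)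
    (hβm.comp (by fun_prop : Measurable fun y : ℝ => (y, s, t))) (fun y => hβnn y s t)
    (hmass s hs t ht) (hb s hs t ht)
    (hβm.comp (by fun_prop : Measurable fun y : ℝ => (y, t, s))) (fun y => hβnn y t s)
    (hmass t ht s hs) (hb t ht s hs)
  have hel := elem_bound hk₀ hl₁ hl₁₂ hl₂ hs' ht'
  have hPhi : 0 ≤ Phi l₁ l₂ s t := by unfold Phi; positivity
  have hm := le_max_left (s ^ k₀) (s ^ (1 + k₀))
  have psk := Real.rpow_pos_of_pos hs' k₀
  have hB : (∫ x₃ in Ioo (0:ℝ) (s + t),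
            max (x₃ ^ k₀) (x₃ ^ (1 + k₀)) * betaOf bs x₃ s t) +
          max (s ^ k₀) (s ^ (1 + k₀)) - max (t ^ k₀) (t ^ (1 + k₀)) ≤
      E₁ * (3 * max (s ^ k₀) (s ^ (1 + k₀)) + t ^ k₀) := by
    unfold betaOf
    have h1 := mul_le_mul_of_nonneg_left hm (by linarith : 0 ≤ E₁)
    have h2 := mul_le_mul_of_nonneg_right hE₁ (psk.le.trans hm)
    linarith
  have h1 := mul_le_mul_of_nonneg_left hB hPhi
  have h2 := mul_le_mul_of_nonneg_left hel (by linarith : 0 ≤ E₁)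
  linarith

end
end

section
/- Let ν ∈ (−2,−1] and let β be the power-law fragment daughter distribution with exponent ν, i.e. β(x₃,x₁,x₂) = (ν+2)[x₃^ν x₁^{−ν−1} 1_{(0,x₁)}(x₃) + x₃^ν x₂^{−ν−1} 1_{(0,x₂)}(x₃)]. Let k > 0 satisfy k+ν+1 > 0 and let ς(x) = x^k. Then for all (x₁,x₂) ∈ (0,∞)², Υ_ς(x₁,x₂) = ((1−k)/(k+ν+1)) (x₁^k + x₂^k). -/
open MeasureTheory Set Filter
open scoped ENNReal

noncomputable section

/-- Integrability and value of one half of the daughter contribution. -/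
theorem powerlaw_half (ν k a s : ℝ) (hkν : 0 < k + ν + 1) (ha : 0 < a) (has : a ≤ s) :
    IntegrableOn ((Ioo (0:ℝ) a).indicator
      (fun x => ((ν + 2) * a ^ (-ν - 1)) * x ^ (k + ν))) (Ioo (0:ℝ) s) ∧
    ∫ x in Ioo (0:ℝ) s, (Ioo (0:ℝ) a).indicator
      (fun x => ((ν + 2) * a ^ (-ν - 1)) * x ^ (k + ν)) x = (ν + 2) / (k + ν + 1) * a ^ k := by
  have hsub : Ioo (0:ℝ) s ∩ Ioo (0:ℝ) a = Ioo (0:ℝ) a :=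
    inter_eq_right.2 (Ioo_subset_Ioo_right has)
  have hint : IntegrableOn (fun x : ℝ => x ^ (k + ν)) (Ioo (0:ℝ) a) := by
    have h := intervalIntegral.intervalIntegrable_rpow' (a := 0) (b := a) (r := k + ν)
      (by linarith)
    rw [intervalIntegrable_iff_integrableOn_Ioo_of_le ha.le] at h
    exact h
  constructor
  · rw [integrableOn_indicator_iff measurableSet_Ioo, inter_comm, hsub]
    exact hint.const_mul _
  · rw [setIntegral_indicator measurableSet_Ioo, hsub, integral_const_mul,
      ← integral_Ioc_eq_integral_Ioo, ← intervalIntegral.integral_of_le ha.le,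
      integral_rpow (Or.inl (by linarith)), Real.zero_rpow hkν.ne']
    have e : a ^ k = a ^ (-ν - 1) * a ^ (k + ν + 1) := by
      rw [← Real.rpow_add ha]; congr 1; ring
    rw [e]; ring

/-- Exact computation of `Υ_ς` for `ς(x) = x^k` and the power-law
daughter distribution. -/
theorem upsilon_powerlaw_identity
    (ν k : ℝ) (hν : ν ∈ Ioc (-2:ℝ) (-1)) (hk : 0 < k) (hkν : 0 < k + ν + 1) :
    ∀ x₁ ∈ Ioi (0:ℝ), ∀ x₂ ∈ Ioi (0:ℝ),
      Upsilon (betaPow ν) (fun x => x ^ k) x₁ x₂ =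
        (1 - k) / (k + ν + 1) * (x₁ ^ k + x₂ ^ k) := by
  intro x₁ hx₁ x₂ hx₂
  rw [mem_Ioi] at hx₁ hx₂
  obtain ⟨i1, e1⟩ := powerlaw_half ν k x₁ (x₁ + x₂) hkν hx₁ (by linarith)
  obtain ⟨i2, e2⟩ := powerlaw_half ν k x₂ (x₁ + x₂) hkν hx₂ (by linarith)
  have hcong : ∫ x₃ in Ioo (0:ℝ) (x₁ + x₂), x₃ ^ k * betaOf (betaPow ν) x₃ x₁ x₂ =
      ∫ x₃ in Ioo (0:ℝ) (x₁ + x₂), ((Ioo (0:ℝ) x₁).indicator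
        (fun x => ((ν + 2) * x₁ ^ (-ν - 1)) * x ^ (k + ν)) x₃ + (Ioo (0:ℝ) x₂).indicator
        (fun x => ((ν + 2) * x₂ ^ (-ν - 1)) * x ^ (k + ν)) x₃) := by
    refine setIntegral_congr_fun measurableSet_Ioo fun x hx => ?_
    have hadd : x ^ (k + ν) = x ^ k * x ^ ν := Real.rpow_add hx.1 k ν
    simp only [betaOf, betaPow, indicator_apply, hadd]
    split_ifs <;> ring
  unfold Upsilon
  simp only []
  rw [hcong, integral_add i1 i2, e1, e2]
  field_simp
  ring

end
end

section
/- Let 0 < k ≤ k₀ < 1 and θ ∈ (0,1). Define ς_{k,θ} : [0,∞) → ℝ by ς_{k,θ}(x) = (x+θ)^k − θ^k for x ∈ [0,1/θ] and ς_{k,θ}(x) = (1/θ+θ)^k − θ^k for x > 1/θ. Then |ς_{k,θ}(x₁) − ς_{k,θ}(x₂)| ≤ θ^{k−k₀} |x₁ − x₂|^{k₀} for all x₁, x₂ ∈ [0,∞); that is, ς_{k,θ} is Hölder continuous with exponent k₀ and Hölder constant θ^{k−k₀}. -/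
open MeasureTheory Set Filter
open scoped ENNReal

noncomputable section

/-- Key one-sided estimate. -/
theorem aux_rpow_sub_le (k k₀ θ s d : ℝ) (hk : 0 < k) (hkk₀ : k ≤ k₀) (hk₀ : k₀ < 1)
    (hθ : 0 < θ) (hs : θ ≤ s) (hd : 0 ≤ d) :
    (s + d) ^ k - s ^ k ≤ θ ^ (k - k₀) * d ^ k₀ := by
  have hs0 : 0 < s := lt_of_lt_of_le hθ hs
  have ht : 0 ≤ d / s := div_nonneg hd hs0.le
  have h1 : (1 + d / s) ^ k ≤ 1 + (d / s) ^ k₀ := by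
    have h2 : (1 + d / s) ^ k ≤ (1 + d / s) ^ k₀ :=
      Real.rpow_le_rpow_of_exponent_le (by linarith) hkk₀
    have h3 := Real.rpow_add_le_add_rpow (zero_le_one' ℝ) ht (by linarith : 0 ≤ k₀) hk₀.le
    rw [Real.one_rpow] at h3
    linarith
  have h4 : (s + d) ^ k = s ^ k * (1 + d / s) ^ k := by
    rw [← Real.mul_rpow hs0.le (by linarith)]
    congr 1
    field_simp
  have h5 : s ^ k * (d / s) ^ k₀ = s ^ (k - k₀) * d ^ k₀ := by
    rw [Real.div_rpow hd hs0.le, Real.rpow_sub hs0]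
    ring
  have h6 : s ^ (k - k₀) ≤ θ ^ (k - k₀) :=
    Real.rpow_le_rpow_of_nonpos hθ hs (by linarith)
  have h7 := mul_le_mul_of_nonneg_left h1 (Real.rpow_nonneg hs0.le k)
  have h8 := mul_le_mul_of_nonneg_right h6 (Real.rpow_nonneg hd k₀)
  rw [h4]
  linarith

/-- Hölder continuity with exponent `k₀` and constant `θ^{k-k₀}` of the
test function `ς_{k,θ}`. -/
theorem sigma_k_theta_holder
    (k k₀ θ : ℝ) (hk : 0 < k) (hkk₀ : k ≤ k₀) (hk₀ : k₀ < 1)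
    (hθ : θ ∈ Ioo (0:ℝ) 1)
    (ς : ℝ → ℝ)
    (hς : ∀ x : ℝ, 0 ≤ x →
      ς x = if x ≤ 1 / θ then (x + θ) ^ k - θ ^ k else (1 / θ + θ) ^ k - θ ^ k) :
    ∀ x₁ x₂ : ℝ, 0 ≤ x₁ → 0 ≤ x₂ →
      |ς x₁ - ς x₂| ≤ θ ^ (k - k₀) * |x₁ - x₂| ^ k₀ := by
  have hθ0 : 0 < θ := hθ.1
  have hinv : 0 < 1 / θ := by positivity
  have hς' : ∀ x : ℝ, 0 ≤ x → ς x = (min x (1 / θ) + θ) ^ k - θ ^ k := by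
    intro x hx
    rw [hς x hx]
    split_ifs with h
    · rw [min_eq_left h]
    · rw [min_eq_right (not_le.mp h).le]
  have key : ∀ a b : ℝ, 0 ≤ a → a ≤ b →
      |ς b - ς a| ≤ θ ^ (k - k₀) * |b - a| ^ k₀ := by
    intro a b ha hab
    have hm : min a (1 / θ) ≤ min b (1 / θ) := min_le_min_right _ hab
    have hm0 : 0 ≤ min a (1 / θ) := le_min ha hinv.le
    have hd : min b (1 / θ) - min a (1 / θ) ≤ b - a := by
      rcases le_total a (1 / θ) with h | h
      · rw [min_eq_left h]
        linarith [min_le_left b (1 / θ)]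
      · rw [min_eq_right h]
        linarith [min_le_right b (1 / θ)]
    rw [hς' a ha, hς' b (ha.trans hab), abs_of_nonneg (sub_nonneg.mpr hab)]
    have h1 : (min a (1 / θ) + θ) ^ k ≤ (min b (1 / θ) + θ) ^ k :=
      Real.rpow_le_rpow (by linarith) (by linarith) hk.le
    have h2 := aux_rpow_sub_le k k₀ θ (min a (1 / θ) + θ) (min b (1 / θ) - min a (1 / θ))
      hk hkk₀ hk₀ hθ0 (by linarith) (by linarith)
    have h3 : min a (1 / θ) + θ + (min b (1 / θ) - min a (1 / θ)) = min b (1 / θ) + θ := by ring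
    rw [h3] at h2
    have h4 : (min b (1 / θ) - min a (1 / θ)) ^ k₀ ≤ (b - a) ^ k₀ :=
      Real.rpow_le_rpow (by linarith) hd (by linarith)
    have h5 := mul_le_mul_of_nonneg_left h4 (Real.rpow_nonneg hθ0.le (k - k₀))
    rw [abs_of_nonneg (by linarith)]
    linarith
  intro x₁ x₂ h₁ h₂
  rcases le_total x₁ x₂ with h | h
  · rw [abs_sub_comm, abs_sub_comm x₁]
    exact key x₁ x₂ h₁ h
  · exact key x₂ x₁ h₂ h

end
end
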